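/- Lipschitz estimate in time: assume A satisfies (A1)–(A2) and H satisfies (H1)–(H2). Let u be bounded and continuous on [0,T]×ℝ^d, a viscosity solution of ∂_t u − tr(A(x) D_x² u) + H(x, D_x u) = 0 in (0,T)×ℝ^d with u(0,·) = g, where g ∈ W^{2,∞}(ℝ^d), and suppose u is Lipschitz in the space variable uniformly in time. Then there exists a constant κ, depending only on ‖Dg‖_{L^∞(ℝ^d)}, ‖D²g‖_{L^∞(ℝ^d)}, μ, Λ_A and the function Θ, such that |u(t,x) − u(s,x)| ≤ κ|t−s| for all t, s ∈ [0,T] and x ∈ ℝ^d. -/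

import Mathlib

open Set Metric Filter
open scoped ENNReal RealInnerProductSpace

noncomputable section

abbrev Euc (d : ℕ) := EuclideanSpace ℝ (Fin d)

/-- Time partial derivative `∂_t u (t,x)`. -/
def timeDeriv (d : ℕ) (u : ℝ × Euc d → ℝ) (t : ℝ) (x : Euc d) : ℝ :=
  deriv (fun s => u (s, x)) t

/-- Spatial partial derivative `∂_{x_i} u (t,x)`. -/
def spacePartial (d : ℕ) (i : Fin d) (u : ℝ × Euc d → ℝ) (t : ℝ) (x : Euc d) : ℝ :=
  fderiv ℝ (fun y => u (t, y)) x (EuclideanSpace.single i 1)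

/-- Spatial gradient `D_x u (t,x)`. -/
def spaceGrad (d : ℕ) (u : ℝ × Euc d → ℝ) (t : ℝ) (x : Euc d) : Euc d :=
  (EuclideanSpace.equiv (Fin d) ℝ).symm (fun i => spacePartial d i u t x)

/-- Spatial Hessian matrix `D_x² u (t,x)`. -/
def spaceHessian (d : ℕ) (u : ℝ × Euc d → ℝ) (t : ℝ) (x : Euc d) :
    Matrix (Fin d) (Fin d) ℝ :=
  Matrix.of fun i j => spacePartial d i (fun p => spacePartial d j u p.1 p.2) t x

/-- The quasilinear parabolic operator `∂_t u - tr(A(x) D_x² u) + H(x, D_x u)`. -/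
def parabolicOp (d : ℕ) (A : Euc d → Matrix (Fin d) (Fin d) ℝ) (H : Euc d → Euc d → ℝ)
    (u : ℝ × Euc d → ℝ) (t : ℝ) (x : Euc d) : ℝ :=
  timeDeriv d u t x - Matrix.trace (A x * spaceHessian d u t x) + H x (spaceGrad d u t x)

/-- Viscosity subsolution of `∂_t u - tr(A(x) D_x² u) + H(x, D_x u) = 0` in `(0,T) × U`. -/
def IsViscSubsolution (d : ℕ) (A : Euc d → Matrix (Fin d) (Fin d) ℝ)
    (H : Euc d → Euc d → ℝ) (T : ℝ) (U : Set (Euc d)) (v : ℝ × Euc d → ℝ) : Prop :=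
  ∀ φ : ℝ × Euc d → ℝ, ContDiff ℝ 2 φ → ∀ t₀ ∈ Ioo (0 : ℝ) T, ∀ x₀ ∈ U,
    IsLocalMaxOn (fun p => v p - φ p) (Ioo 0 T ×ˢ U) (t₀, x₀) →
    parabolicOp d A H φ t₀ x₀ ≤ 0

/-- Viscosity supersolution of `∂_t u - tr(A(x) D_x² u) + H(x, D_x u) = 0` in `(0,T) × U`. -/
def IsViscSupersolution (d : ℕ) (A : Euc d → Matrix (Fin d) (Fin d) ℝ)
    (H : Euc d → Euc d → ℝ) (T : ℝ) (U : Set (Euc d)) (w : ℝ × Euc d → ℝ) : Prop :=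
  ∀ φ : ℝ × Euc d → ℝ, ContDiff ℝ 2 φ → ∀ t₀ ∈ Ioo (0 : ℝ) T, ∀ x₀ ∈ U,
    IsLocalMinOn (fun p => w p - φ p) (Ioo 0 T ×ˢ U) (t₀, x₀) →
    0 ≤ parabolicOp d A H φ t₀ x₀

/-- Frobenius norm of a real matrix. -/
def matFrobNorm {k l : ℕ} (Mm : Matrix (Fin k) (Fin l) ℝ) : ℝ :=
  Real.sqrt (∑ i, ∑ j, (Mm i j) ^ 2)

/-- Conditions (A1)–(A2): `A = σ σᵀ` with `σ` bounded and Lipschitz with constant `Λ_A`. -/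
def CondA (d : ℕ) (ΛA : ℝ) (A : Euc d → Matrix (Fin d) (Fin d) ℝ) : Prop :=
  ∃ n : ℕ, ∃ σ : Euc d → Matrix (Fin d) (Fin n) ℝ,
    (∀ x, A x = σ x * (σ x).transpose) ∧
    (∀ x, matFrobNorm (σ x) ≤ ΛA) ∧
    (∀ x y, matFrobNorm (σ x - σ y) ≤ ΛA * ‖x - y‖)

/-- Condition (A3): entries of `A` are `C¹`. -/
def CondA3 (d : ℕ) (A : Euc d → Matrix (Fin d) (Fin d) ℝ) : Prop :=
  ∀ i j, ContDiff ℝ 1 (fun x : Euc d => A x i j)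

/-- Condition (A4): uniform ellipticity `⟨A(x)ξ, ξ⟩ ≥ λ|ξ|²`. -/
def CondA4 (d : ℕ) (lam : ℝ) (A : Euc d → Matrix (Fin d) (Fin d) ℝ) : Prop :=
  ∀ x ξ : Euc d, lam * ‖ξ‖ ^ 2 ≤ ∑ i, ∑ j, A x i j * ξ j * ξ i

/-- Condition (H3). -/
def CondH3 (d : ℕ) (m Λ : ℝ) (H : Euc d → Euc d → ℝ) : Prop :=
  ∀ x p q : Euc d, |H x p - H x q| ≤ Λ * (‖p‖ + ‖q‖ + 1) ^ (m - 1) * ‖p - q‖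

/-- Condition (H4) with parameter `μ`. -/
def CondH4 (d : ℕ) (m Λ μ : ℝ) (a M : ℝ → ℝ) (H : Euc d → Euc d → ℝ) : Prop :=
  ∀ r : ℝ, 0 < r →
    (a r ∈ Ioc (0 : ℝ) 1 ∧ 1 ≤ M r) ∧
    (∀ x ∈ ball (0 : Euc d) r, ∀ p : Euc d,
      max (-μ) (a r * ‖p‖ ^ m - M r) ≤ H x p ∧ H x p ≤ Λ * (‖p‖ ^ m + 1)) ∧
    (∀ x ∈ ball (0 : Euc d) r, ∀ y ∈ ball (0 : Euc d) r, ∀ p : Euc d,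
      |H x p - H y p| ≤ (Λ * ‖p‖ ^ m + M r) * ‖x - y‖)

/-- Condition (H4) with `μ = +∞`. -/
def CondH4top (d : ℕ) (m Λ : ℝ) (a M : ℝ → ℝ) (H : Euc d → Euc d → ℝ) : Prop :=
  ∀ r : ℝ, 0 < r →
    (a r ∈ Ioc (0 : ℝ) 1 ∧ 1 ≤ M r) ∧
    (∀ x ∈ ball (0 : Euc d) r, ∀ p : Euc d,
      a r * ‖p‖ ^ m - M r ≤ H x p ∧ H x p ≤ Λ * (‖p‖ ^ m + 1)) ∧
    (∀ x ∈ ball (0 : Euc d) r, ∀ y ∈ ball (0 : Euc d) r, ∀ p : Euc d,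
      |H x p - H y p| ≤ (Λ * ‖p‖ ^ m + M r) * ‖x - y‖)

/-- `limsup_{|x|→∞, x∈U} sup_{t∈[0,T]} v(t,x)/(1+|x|) ≤ 0`. -/
def SublinearAbove (d : ℕ) (T : ℝ) (U : Set (Euc d)) (v : ℝ × Euc d → ℝ) : Prop :=
  ∀ ε : ℝ, 0 < ε → ∃ R : ℝ, ∀ x ∈ U, R ≤ ‖x‖ → ∀ t ∈ Icc (0 : ℝ) T, v (t, x) ≤ ε * (1 + ‖x‖)

/-- `liminf_{|x|→∞, x∈U} inf_{t∈[0,T]} w(t,x)/(1+|x|) ≥ 0`. -/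
def SublinearBelow (d : ℕ) (T : ℝ) (U : Set (Euc d)) (w : ℝ × Euc d → ℝ) : Prop :=
  ∀ ε : ℝ, 0 < ε → ∃ R : ℝ, ∀ x ∈ U, R ≤ ‖x‖ → ∀ t ∈ Icc (0 : ℝ) T, -(ε * (1 + ‖x‖)) ≤ w (t, x)

/-- Parabolic boundary `({0} × U) ∪ ([0,T) × ∂U)`. -/
def parabolicBoundary (d : ℕ) (T : ℝ) (U : Set (Euc d)) : Set (ℝ × Euc d) :=
  ({0} ×ˢ U) ∪ (Ico 0 T ×ˢ frontier U)

/-- Condition (H1): `-μ ≤ H(x,p) ≤ Θ(|p|)` with `Θ` continuous, nondecreasing, coercive. -/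
def CondH1 (d : ℕ) (μ : ℝ) (Θ : ℝ → ℝ) (H : Euc d → Euc d → ℝ) : Prop :=
  Continuous Θ ∧ Monotone Θ ∧ Tendsto Θ atTop atTop ∧
  ∀ (x p : Euc d), -μ ≤ H x p ∧ H x p ≤ Θ ‖p‖

/-- Condition (H2): `H` uniformly continuous on `ℝ^d × B_r` for every `r > 0`. -/
def CondH2 (d : ℕ) (H : Euc d → Euc d → ℝ) : Prop :=
  ∀ r : ℝ, 0 < r →
    UniformContinuousOn (fun q : Euc d × Euc d => H q.1 q.2)
      ((univ : Set (Euc d)) ×ˢ ball (0 : Euc d) r)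

open MeasureTheory Topology in
theorem lin_bound {N : Type*} [NormedAddCommGroup N] [NormedSpace ℝ N]
    (l : N →L[ℝ] ℝ) (lam d : ℝ) (hl : 0 < lam) (hd : 0 ≤ d)
    (h : ∀ v, l v ≤ lam * (‖v‖ ^ 2 + d ^ 2)) : ‖l‖ ≤ 2 * lam * d := by
  have key : ∀ d', 0 < d' → d ≤ d' → ‖l‖ ≤ 2 * lam * d' := by
    intro d' hd' hdd
    have h1 : ∀ v, l v ≤ 2 * lam * d' * ‖v‖ := by
      intro v
      by_cases hv : v = 0
      · simp [hv]
      have hv' : 0 < ‖v‖ := norm_pos_iff.2 hv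
      have := h ((d' / ‖v‖) • v)
      rw [map_smul, norm_smul, Real.norm_of_nonneg (by positivity), div_mul_cancel₀ _ hv'.ne',
        smul_eq_mul] at this
      have h2 : d' / ‖v‖ * l v ≤ lam * (2 * d' ^ 2) := this.trans (by
        have : d ^ 2 ≤ d' ^ 2 := by gcongr
        nlinarith)
      rw [div_mul_eq_mul_div, div_le_iff₀ hv'] at h2
      have : d' * l v ≤ d' * (2 * lam * d' * ‖v‖) := by nlinarith
      exact le_of_mul_le_mul_left this hd'
    refine l.opNorm_le_bound (by positivity) fun v => ?_
    rw [Real.norm_eq_abs, abs_le]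
    refine ⟨?_, h1 v⟩
    have := h1 (-v)
    rw [map_neg, norm_neg] at this
    linarith
  refine le_of_forall_pos_le_add fun e he => ?_
  have := key (d + e / (2 * lam)) (by positivity) (by have : 0 < e / (2 * lam) := by positivity
                                                      linarith)
  calc _ ≤ _ := this
    _ = _ := by field_simp

theorem one_dim (g : ℝ → ℝ) (a b : ℝ) (hb : 0 ≤ b)
    (h : ∀ s t, 0 ≤ s → s ≤ t → t ≤ 1 → g t - g s ≤ a * (t - s) + b * (t - s) ^ 2) :
    g 1 - g 0 ≤ a := by
  have key : ∀ n : ℕ, g 1 - g 0 ≤ a + b / (n + 1) := by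
    intro n
    have h1 : ∀ k : ℕ, k ≤ n + 1 →
        g (k / (n + 1)) - g 0 ≤ k * (a * (1 / (n + 1)) + b * (1 / (n + 1)) ^ 2) := by
      intro k
      induction k with
      | zero => intro _; simp
      | succ k ih =>
        intro hk
        have := ih (by omega)
        have h2 := h (k / (n + 1)) ((k + 1 : ℕ) / (n + 1)) (by positivity)
          (by gcongr; simp) (by rw [div_le_one (by positivity)]; exact_mod_cast hk)
        have h3 : ((k + 1 : ℕ) : ℝ) / (n + 1) - k / (n + 1) = 1 / (n + 1) := by
          push_cast; field_simp; ring
        rw [h3] at h2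
        push_cast at h2 ⊢
        linarith
    have := h1 (n + 1) le_rfl
    push_cast at this
    rw [div_self (by positivity)] at this
    calc _ ≤ _ := this
      _ = _ := by field_simp
  have h2 : Tendsto (fun n : ℕ => a + b / ((n : ℝ) + 1)) atTop (nhds (a + 0)) :=
    tendsto_const_nhds.add (tendsto_const_div_atTop_nhds_zero_nat b |>.comp (tendsto_add_atTop_nat 1)
      |>.congr (by intro n; simp))
  rw [add_zero] at h2
  exact ge_of_tendsto' h2 key

/-- Quantitative slope comparison at a contact point. -/
theorem slope_bound {N : Type*} [NormedAddCommGroup N] [NormedSpace ℝ N]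
    (f : N → ℝ) (lam : ℝ) (hl : 0 < lam)
    (hsub : ∀ ξ, ∃ q : N →L[ℝ] ℝ, ∀ x, f ξ + q (x - ξ) - lam * ‖x - ξ‖ ^ 2 ≤ f x)
    (ζ ξ : N) (p q : N →L[ℝ] ℝ) (hp : ∀ x, f x - p x ≤ f ζ - p ζ)
    (hq : ∀ x, f ξ + q (x - ξ) - lam * ‖x - ξ‖ ^ 2 ≤ f x) :
    ‖q - p‖ ≤ 2 * lam * ‖ξ - ζ‖ := by
  obtain ⟨q0, hq0⟩ := hsub ζ
  have e0 : q0 - p = 0 := by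
    have := lin_bound (q0 - p) lam 0 hl le_rfl (by
      intro v
      have h1 := hq0 (ζ + v)
      have h2 := hp (ζ + v)
      simp only [add_sub_cancel_left, map_add] at h1 h2
      simp only [ContinuousLinearMap.sub_apply]
      nlinarith)
    simpa using this
  have e0' : q0 = p := sub_eq_zero.1 e0
  subst e0'
  refine lin_bound _ lam _ hl (norm_nonneg _) fun v => ?_
  have h1 := hq (ξ + v)
  have h2 := hp (ξ + v)
  have h3 := hq0 ξ
  simp only [add_sub_cancel_left, map_add, map_sub] at h1 h2 h3
  simp only [ContinuousLinearMap.sub_apply]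
  nlinarith

open MeasureTheory Topology Measure in
theorem jensen_alex {N : Type*} [NormedAddCommGroup N] [NormedSpace ℝ N] [FiniteDimensional ℝ N]
    (f : N → ℝ) (lam : ℝ) (hl : 0 < lam)
    (hsub : ∀ ξ, ∃ q : N →L[ℝ] ℝ, ∀ x, f ξ + q (x - ξ) - lam * ‖x - ξ‖ ^ 2 ≤ f x)
    (δ : ℝ) (hδ : 0 < δ)
    (hmax : ∀ p : N →L[ℝ] ℝ, ‖p‖ < δ → ∃ ζ, ∀ x, f x - p x ≤ f ζ - p ζ) :
    ∃ (ζ : N) (p : N →L[ℝ] ℝ) (M : N →L[ℝ] N →L[ℝ] ℝ), ‖p‖ < δ ∧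
      (∀ x, f x - p x ≤ f ζ - p ζ) ∧
      ∀ c > 0, ∃ r > 0, ∀ η, ‖η‖ ≤ r →
        |f (ζ + η) - f ζ - p η - M η η / 2| ≤ c * ‖η‖ ^ 2 := by
  classical
  borelize N
  borelize (N →L[ℝ] ℝ)
  let K : Set N := {ζ | ∃ p : N →L[ℝ] ℝ, ‖p‖ < δ ∧ ∀ x, f x - p x ≤ f ζ - p ζ}
  have hK : ∀ ζ, ∃ p : N →L[ℝ] ℝ, ζ ∈ K → ‖p‖ < δ ∧ ∀ x, f x - p x ≤ f ζ - p ζ := by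
    intro ζ
    by_cases h : ζ ∈ K
    · obtain ⟨p, hp⟩ := h
      exact ⟨p, fun _ => hp⟩
    · exact ⟨0, fun h' => absurd h' h⟩
  choose P hP using hK
  -- contact gradients are subgradients
  have hcs : ∀ ζ p, (∀ x, f x - p x ≤ f ζ - p ζ) →
      ∀ x, f ζ + (p : N →L[ℝ] ℝ) (x - ζ) - lam * ‖x - ζ‖ ^ 2 ≤ f x := by
    intro ζ p hp x
    obtain ⟨q, hq⟩ := hsub ζ
    have := slope_bound f lam hl hsub ζ ζ p q hp hq
    simp only [sub_self, norm_zero, mul_zero, norm_le_zero_iff] at this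
    rw [← sub_eq_zero.1 this]
    exact hq x
  have hLip : LipschitzOnWith (2 * lam).toNNReal P K := by
    refine LipschitzOnWith.of_dist_le_mul fun x hx y hy => ?_
    rw [dist_eq_norm, dist_eq_norm, Real.coe_toNNReal _ (by positivity)]
    exact slope_bound f lam hl hsub y x (P y) (P x) (hP y hy).2 (hcs x _ (hP x hx).2)
  have hsurj : ball (0 : N →L[ℝ] ℝ) δ ⊆ P '' K := by
    intro p hp
    rw [mem_ball_zero_iff] at hp
    obtain ⟨ζ, hζ⟩ := hmax p hp
    have hζK : ζ ∈ K := ⟨p, hp, hζ⟩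
    refine ⟨ζ, hζK, ?_⟩
    have := slope_bound f lam hl hsub ζ ζ p (P ζ) hζ (hcs ζ _ (hP ζ hζK).2)
    simp only [sub_self, norm_zero, mul_zero, norm_le_zero_iff] at this
    exact sub_eq_zero.1 this
  have hfin : Module.finrank ℝ (N →L[ℝ] ℝ) = Module.finrank ℝ N := by
    rw [← (LinearMap.toContinuousLinearMap (𝕜 := ℝ) (E := N) (F' := ℝ)).finrank_eq]
    exact Subspace.dual_finrank_eq
  let μ : Measure N := μH[Module.finrank ℝ N]
  have hμK : μ K ≠ 0 := by
    intro h0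
    have h1 := hLip.hausdorffMeasure_image_le (d := (Module.finrank ℝ N : ℝ)) (by positivity)
    rw [show (μH[(Module.finrank ℝ N : ℝ)] : Measure N) K = 0 from h0, mul_zero] at h1
    have h2 : (μH[(Module.finrank ℝ (N →L[ℝ] ℝ) : ℝ)] : Measure (N →L[ℝ] ℝ)) (ball 0 δ) = 0 := by
      rw [hfin]
      exact le_antisymm ((measure_mono hsurj).trans h1) bot_le
    exact (measure_ball_pos _ _ hδ).ne' h2
  have hdens : ∀ᵐ x ∂μ.restrict K, ∀ n : ℕ,
    ∀ {ι : Type _} {l : Filter ι} (w : ι → N) (δ : ι → ℝ) (_ : Tendsto δ l (𝓝[>] 0))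
      (_ : ∀ᶠ j in l, x ∈ closedBall (w j) ((n : ℝ) * δ j)),
      Tendsto (fun j => μ (K ∩ closedBall (w j) (δ j)) / μ (closedBall (w j) (δ j))) l (𝓝 1) := by
    rw [ae_all_iff]
    intro n
    exact IsUnifLocDoublingMeasure.ae_tendsto_measure_inter_div μ K n
  have hdiff : ∀ᵐ x ∂μ, x ∈ K → DifferentiableWithinAt ℝ P K x :=
    hLip.ae_differentiableWithinAt_of_mem
  have hne : (μ.restrict K) ≠ 0 := by
    rwa [Ne, Measure.restrict_eq_zero]
  have hmem : ∃ ζ, ζ ∈ K ∧ (∀ n : ℕ,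
    ∀ {ι : Type _} {l : Filter ι} (w : ι → N) (δ : ι → ℝ) (_ : Tendsto δ l (𝓝[>] 0))
      (_ : ∀ᶠ j in l, ζ ∈ closedBall (w j) ((n : ℝ) * δ j)),
      Tendsto (fun j => μ (K ∩ closedBall (w j) (δ j)) / μ (closedBall (w j) (δ j))) l (𝓝 1)) ∧
      DifferentiableWithinAt ℝ P K ζ := by
    by_contra hcon
    apply hμK
    have h1 : ∀ᵐ x ∂μ.restrict K, ¬ (x ∈ K) := by
      filter_upwards [hdens, ae_restrict_of_ae hdiff] with x hx1 hx2 hx3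
      exact hcon ⟨x, hx3, hx1, hx2 hx3⟩
    rw [ae_iff] at h1
    simp only [not_not, setOf_mem_eq] at h1
    rwa [Measure.restrict_apply_self] at h1
  obtain ⟨ζ, hζK, hd, hD⟩ := hmem
  obtain ⟨M, hM⟩ := hD
  have hdens' : ∀ θ > 0, ∃ r > 0, ∀ η : N, ‖η‖ ≤ r → ∃ ζ' ∈ K, ‖ζ' - (ζ + η)‖ ≤ θ * ‖η‖ := by
    intro θ hθ
    obtain ⟨n, hn⟩ := exists_nat_gt (1 / θ)
    have hn0 : 0 < (n : ℝ) := lt_trans (by positivity) hn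
    have h1 := hd n (l := 𝓝[≠] (0 : N)) (fun η => ζ + η) (fun η => 1 / n * ‖η‖) (by
      rw [tendsto_nhdsWithin_iff]
      constructor
      · have : Tendsto (fun η : N => 1 / (n : ℝ) * ‖η‖) (𝓝 0) (𝓝 (1 / n * ‖(0 : N)‖)) := by
          apply Continuous.tendsto; fun_prop
        simp only [norm_zero, mul_zero] at this
        exact this.mono_left nhdsWithin_le_nhds
      · filter_upwards [self_mem_nhdsWithin] with η hη
        have : 0 < ‖η‖ := norm_pos_iff.2 hη
        simp only [mem_Ioi]; positivity) (by
      refine Eventually.of_forall fun η => ?_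
      rw [mem_closedBall, dist_eq_norm]
      simp only [sub_add_cancel_left, norm_neg]
      rw [← mul_assoc, mul_one_div_cancel hn0.ne', one_mul])
    have h2 := h1.eventually (lt_mem_nhds (zero_lt_one))
    rw [eventually_nhdsWithin_iff, Metric.eventually_nhds_iff] at h2
    obtain ⟨r, hr, h2⟩ := h2
    refine ⟨r / 2, by positivity, fun η hη => ?_⟩
    by_cases h0 : η = 0
    · exact ⟨ζ, hζK, by simp [h0]⟩
    have h3 := h2 (y := η) (by rw [dist_zero_right]; linarith) h0
    have h4 : (K ∩ closedBall (ζ + η) (1 / n * ‖η‖)).Nonempty := by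
      by_contra hemp
      rw [not_nonempty_iff_eq_empty] at hemp
      rw [hemp] at h3
      simp at h3
    obtain ⟨ζ', h5, h6⟩ := h4
    refine ⟨ζ', h5, ?_⟩
    rw [mem_closedBall, dist_eq_norm] at h6
    refine h6.trans ?_
    gcongr
    rw [div_le_iff₀ hn0]
    rw [div_lt_iff₀ hθ] at hn
    linarith
  have hslope : ∀ c > 0, ∃ r > 0, ∀ η : N, ‖η‖ ≤ r → ∀ q : N →L[ℝ] ℝ,
      (∀ x, f (ζ + η) + q (x - (ζ + η)) - lam * ‖x - (ζ + η)‖ ^ 2 ≤ f x) →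
      ‖q - P ζ - M η‖ ≤ c * ‖η‖ := by
    intro c hc
    set θ := min 1 (c / (2 * (2 * lam + ‖M‖ + 1))) with hθdef
    have hden : 0 < 2 * (2 * lam + ‖M‖ + 1) := by positivity
    have hθ : 0 < θ := by positivity
    obtain ⟨r1, hr1, h1⟩ := hdens' θ hθ
    have hM2 := hM.isLittleO.bound (show 0 < c / 4 by positivity)
    rw [eventually_nhdsWithin_iff, Metric.eventually_nhds_iff] at hM2
    obtain ⟨r2, hr2, h2⟩ := hM2
    refine ⟨min r1 (r2 / 4), by positivity, fun η hη q hq => ?_⟩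
    obtain ⟨ζ', hζ', h3⟩ := h1 η (hη.trans (min_le_left _ _))
    have hη2 : ‖η‖ ≤ r2 / 4 := hη.trans (min_le_right _ _)
    have h4 : ‖ζ' - ζ‖ ≤ 2 * ‖η‖ := by
      have : ζ' - ζ = (ζ' - (ζ + η)) + η := by abel
      rw [this]
      refine (norm_add_le _ _).trans ?_
      have : θ * ‖η‖ ≤ 1 * ‖η‖ := by gcongr; exact min_le_left _ _
      linarith
    have h5 := h2 (y := ζ') (by rw [dist_eq_norm]; linarith) hζ'
    have h6 := slope_bound f lam hl hsub ζ' (ζ + η) (P ζ') q (hP ζ' hζ').2 hq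
    rw [norm_sub_rev (ζ + η)] at h6
    have h7 : ‖M (ζ' - (ζ + η))‖ ≤ ‖M‖ * (θ * ‖η‖) :=
      (M.le_opNorm _).trans (by gcongr)
    have h8 : q - P ζ - M η = (q - P ζ') + (P ζ' - P ζ - M (ζ' - ζ)) + M (ζ' - (ζ + η)) := by
      simp only [map_sub, map_add]; abel
    rw [h8]
    have h9 : θ * (2 * (2 * lam + ‖M‖ + 1)) ≤ c := by
      rw [← le_div_iff₀ hden]; exact min_le_right _ _
    refine (norm_add₃_le).trans ?_
    have h10 : 2 * lam * ‖ζ' - (ζ + η)‖ ≤ 2 * lam * (θ * ‖η‖) := by gcongr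
    have h11 : c / 4 * ‖ζ' - ζ‖ ≤ c / 4 * (2 * ‖η‖) := by gcongr
    have h12 := mul_le_mul_of_nonneg_right h9 (norm_nonneg η)
    have h13 : 0 ≤ θ * ‖η‖ := by positivity
    nlinarith
  refine ⟨ζ, P ζ, M, (hP ζ hζK).1, (hP ζ hζK).2, fun c hc => ?_⟩
  obtain ⟨r, hr, h1⟩ := hslope c hc
  refine ⟨r, hr, fun η hη => ?_⟩
  have hq : ∀ τ : ℝ, ∃ q : N →L[ℝ] ℝ, (∀ x, f (ζ + τ • η) + q (x - (ζ + τ • η))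
      - lam * ‖x - (ζ + τ • η)‖ ^ 2 ≤ f x) := fun τ => hsub _
  have hqb : ∀ τ : ℝ, 0 ≤ τ → τ ≤ 1 → ∀ q : N →L[ℝ] ℝ, (∀ x, f (ζ + τ • η) + q (x - (ζ + τ • η))
      - lam * ‖x - (ζ + τ • η)‖ ^ 2 ≤ f x) → |q η - P ζ η - τ * M η η| ≤ c * ‖η‖ ^ 2 := by
    intro τ h0 h1' q hq
    have hn : ‖τ • η‖ ≤ ‖η‖ := by
      rw [norm_smul, Real.norm_of_nonneg h0]
      nlinarith [norm_nonneg η]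
    have h2 := h1 (τ • η) (hn.trans hη) q hq
    have h3 := (q - P ζ - M (τ • η)).le_opNorm η
    simp only [ContinuousLinearMap.sub_apply, map_smul, ContinuousLinearMap.smul_apply,
      smul_eq_mul, Real.norm_eq_abs] at h3
    refine h3.trans ?_
    have : ‖q - P ζ - M (τ • η)‖ ≤ c * ‖η‖ := h2.trans (by gcongr)
    rw [map_smul] at this
    nlinarith [norm_nonneg η]
  set a := M η η with ha
  set b := |a| / 2 + lam * ‖η‖ ^ 2 with hb
  have hb0 : 0 ≤ b := by positivity
  -- upper and lower increments
  have hup : ∀ s t, 0 ≤ s → s ≤ t → t ≤ 1 →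
      f (ζ + t • η) - f (ζ + s • η) ≤ (t - s) * (P ζ η + t * a + c * ‖η‖ ^ 2)
        + lam * ‖η‖ ^ 2 * (t - s) ^ 2 := by
    intro s t hs hst ht
    obtain ⟨q, hq⟩ := hq t
    have h2 := abs_le.1 (hqb t (hs.trans hst) ht q hq)
    have h3 := hq (ζ + s • η)
    have h4 : ζ + s • η - (ζ + t • η) = (s - t) • η := by rw [sub_smul]; abel
    rw [h4, map_smul, norm_smul, mul_pow, smul_eq_mul, Real.norm_eq_abs, sq_abs] at h3
    nlinarith [mul_nonneg (sub_nonneg.2 hst) (sub_nonneg.2 h2.2)]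
  have hlo : ∀ s t, 0 ≤ s → s ≤ t → t ≤ 1 →
      (t - s) * (P ζ η + s * a - c * ‖η‖ ^ 2)
        - lam * ‖η‖ ^ 2 * (t - s) ^ 2 ≤ f (ζ + t • η) - f (ζ + s • η) := by
    intro s t hs hst ht
    obtain ⟨q, hq⟩ := hq s
    have h2 := abs_le.1 (hqb s hs (hst.trans ht) q hq)
    have h3 := hq (ζ + t • η)
    have h4 : ζ + t • η - (ζ + s • η) = (t - s) • η := by rw [sub_smul]; abel
    rw [h4, map_smul, norm_smul, mul_pow, smul_eq_mul, Real.norm_eq_abs, sq_abs] at h3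
    nlinarith [mul_nonneg (sub_nonneg.2 hst) (sub_nonneg.2 h2.1)]
  have hA := one_dim (fun τ => f (ζ + τ • η) - τ * P ζ η - τ ^ 2 / 2 * a) (c * ‖η‖ ^ 2) b hb0 (by
    intro s t hs hst ht
    have h2 := hup s t hs hst ht
    have h3 := le_abs_self a
    have h4 : 0 ≤ (t - s) ^ 2 * (|a| - a) := mul_nonneg (sq_nonneg _) (by linarith)
    simp only [hb]
    nlinarith)
  have hB := one_dim (fun τ => -(f (ζ + τ • η) - τ * P ζ η - τ ^ 2 / 2 * a)) (c * ‖η‖ ^ 2) b hb0 (by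
    intro s t hs hst ht
    have h2 := hlo s t hs hst ht
    have h3 := le_abs_self a
    have h4 : 0 ≤ (t - s) ^ 2 * (|a| - a) := mul_nonneg (sq_nonneg _) (by linarith)
    simp only [hb]
    nlinarith)
  simp only [one_smul, zero_smul, add_zero, one_mul, zero_mul, sub_zero] at hA hB
  rw [abs_le]
  constructor <;> norm_num at hA hB ⊢ <;> linarith

theorem attain {F : Type*} [NormedAddCommGroup F] [ProperSpace F] (S : Set F) (hS : IsClosed S)
    (hne : S.Nonempty) (g : F → ℝ) (hg : ContinuousOn g S) (C c : ℝ) (y : F) (hc : 0 < c)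
    (hb : ∀ x ∈ S, g x ≤ C - c * ‖x - y‖ ^ 2) : ∃ x ∈ S, ∀ x' ∈ S, g x' ≤ g x := by
  obtain ⟨x0, hx0⟩ := hne
  obtain ⟨x, hx, hm⟩ := hg.exists_isMaxOn' hS hx0 (by
    rw [eventually_inf_principal]
    have h1 : Tendsto (fun x => ‖x - y‖) (cocompact F) atTop := by
      have := tendsto_norm_cocompact_atTop (E := F)
      refine tendsto_atTop_mono (f := fun x => ‖x‖ - ‖y‖) (fun x => norm_sub_norm_le x y) ?_
      exact tendsto_atTop_add_const_right _ _ this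
    filter_upwards [h1.eventually_ge_atTop (max 1 ((C - g x0) / c))] with x hx hxS
    have h2 := hb x hxS
    have h3 : 1 ≤ ‖x - y‖ := (le_max_left _ _).trans hx
    have h4 : (C - g x0) / c ≤ ‖x - y‖ := (le_max_right _ _).trans hx
    rw [div_le_iff₀ hc] at h4
    have : ‖x - y‖ * c ≤ c * ‖x - y‖ ^ 2 := by nlinarith [mul_nonneg hc.le (norm_nonneg (x - y))]
    linarith)
  exact ⟨x, hx, fun x' hx' => hm hx'⟩

/-- The doubled functional. -/
def Psi {E : Type*} [NormedAddCommGroup E] [InnerProductSpace ℝ E] (u1 u2 : E → ℝ) (ε β : ℝ)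
    (p1 p2 a b a' b' : E) : ℝ :=
  u1 a' + u2 b' - (‖a - a'‖ ^ 2 + ‖b - b'‖ ^ 2 + ‖a - b‖ ^ 2) / (2 * ε)
    - β * (‖a‖ ^ 2 + ‖b‖ ^ 2) - ⟪p1, a⟫ - ⟪p2, b⟫

theorem psi_attain {E : Type*} [NormedAddCommGroup E] [InnerProductSpace ℝ E]
    [FiniteDimensional ℝ E] (D1 D2 : Set E) (hD1 : IsClosed D1) (hD2 : IsClosed D2)
    (hn1 : D1.Nonempty) (hn2 : D2.Nonempty) (u1 u2 : E → ℝ)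
    (hc1 : ContinuousOn u1 D1) (hc2 : ContinuousOn u2 D2) (C : ℝ)
    (hb1 : ∀ x ∈ D1, u1 x ≤ C) (hb2 : ∀ x ∈ D2, u2 x ≤ C) (ε β : ℝ) (hε : 0 < ε) (hβ : 0 < β)
    (p1 p2 : E) : ∃ a b a' b', a' ∈ D1 ∧ b' ∈ D2 ∧ ∀ c d, ∀ c' ∈ D1, ∀ d' ∈ D2,
      Psi u1 u2 ε β p1 p2 c d c' d' ≤ Psi u1 u2 ε β p1 p2 a b a' b' := by
  haveI : ProperSpace E := FiniteDimensional.proper ℝ E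
  set k := min (1 / (2 * ε)) (β / 2) with hk
  have hk0 : 0 < k := by positivity
  have hk1 : k ≤ 1 / (2 * ε) := min_le_left _ _
  have hk2 : k ≤ β / 2 := min_le_right _ _
  obtain ⟨x, hx, hm⟩ := attain ((univ : Set (E × E)) ×ˢ (D1 ×ˢ D2))
    (isClosed_univ.prod (hD1.prod hD2)) (univ_nonempty.prod (hn1.prod hn2))
    (fun x => Psi u1 u2 ε β p1 p2 x.1.1 x.1.2 x.2.1 x.2.2)
    (by
      have h1 : ContinuousOn (fun x : (E × E) × (E × E) => u1 x.2.1)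
          ((univ : Set (E × E)) ×ˢ (D1 ×ˢ D2)) :=
        hc1.comp (by fun_prop) (fun x hx => hx.2.1)
      have h2 : ContinuousOn (fun x : (E × E) × (E × E) => u2 x.2.2)
          ((univ : Set (E × E)) ×ˢ (D1 ×ˢ D2)) :=
        hc2.comp (by fun_prop) (fun x hx => hx.2.2)
      unfold Psi
      exact ((((h1.add h2).sub (by fun_prop)).sub (by fun_prop)).sub (by fun_prop)).sub (by fun_prop))
    (2 * C + (‖p1‖ ^ 2 + ‖p2‖ ^ 2) / (2 * β)) (k / 2) 0 (by positivity) (by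
      rintro ⟨⟨a, b⟩, ⟨a', b'⟩⟩ ⟨-, ha', hb'⟩
      have e1 := hb1 a' ha'
      have e2 := hb2 b' hb'
      simp only [Psi, sub_zero]
      have q1 : ∀ p v : E, - ⟪p, v⟫ ≤ ‖p‖ ^ 2 / (2 * β) + β / 2 * ‖v‖ ^ 2 := by
        intro p v
        have h1 := neg_le_of_abs_le (abs_real_inner_le_norm p v)
        have h2 : ‖p‖ * ‖v‖ ≤ ‖p‖ ^ 2 / (2 * β) + β / 2 * ‖v‖ ^ 2 := by
          rw [← sub_nonneg]
          have : ‖p‖ ^ 2 / (2 * β) + β / 2 * ‖v‖ ^ 2 - ‖p‖ * ‖v‖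
            = (‖p‖ - β * ‖v‖) ^ 2 / (2 * β) := by field_simp; ring
          rw [this]; positivity
        linarith
      have q2 : ∀ v v' : E, ‖v'‖ ^ 2 ≤ 2 * ‖v‖ ^ 2 + 2 * ‖v - v'‖ ^ 2 := by
        intro v v'
        have h1 : ‖v'‖ ≤ ‖v‖ + ‖v - v'‖ := by
          have := norm_sub_le v (v - v')
          simpa using this
        nlinarith [norm_nonneg v', norm_nonneg v, norm_nonneg (v - v'), sq_nonneg (‖v‖ - ‖v - v'‖)]
      have hN : ‖(((a, b), (a', b')) : (E × E) × (E × E))‖ ^ 2 ≤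
          2 * (‖a‖ ^ 2 + ‖b‖ ^ 2 + ‖a - a'‖ ^ 2 + ‖b - b'‖ ^ 2) := by
        have hh : ∀ x y : ℝ, max x y ^ 2 = x ^ 2 ∨ max x y ^ 2 = y ^ 2 := by
          intro x y; rcases max_choice x y with h | h <;> simp [h]
        have r1 := q2 a a'
        have r2 := q2 b b'
        have s1 := sq_nonneg ‖a‖
        have s2 := sq_nonneg ‖b‖
        have s3 := sq_nonneg ‖a - a'‖
        have s4 := sq_nonneg ‖b - b'‖
        simp only [Prod.norm_def]
        rcases hh (max ‖a‖ ‖b‖) (max ‖a'‖ ‖b'‖) with h | h <;> rw [h]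
        · rcases hh ‖a‖ ‖b‖ with h | h <;> rw [h] <;> linarith
        · rcases hh ‖a'‖ ‖b'‖ with h | h <;> rw [h] <;> linarith
      have t1 := q1 p1 a
      have t2 := q1 p2 b
      have t3 : k * (‖a - a'‖ ^ 2 + ‖b - b'‖ ^ 2) ≤
          (‖a - a'‖ ^ 2 + ‖b - b'‖ ^ 2 + ‖a - b‖ ^ 2) / (2 * ε) := by
        have v1 : k * (‖a - a'‖ ^ 2 + ‖b - b'‖ ^ 2) ≤
          1 / (2 * ε) * (‖a - a'‖ ^ 2 + ‖b - b'‖ ^ 2) := by gcongr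
        have v2 : (‖a - a'‖ ^ 2 + ‖b - b'‖ ^ 2 + ‖a - b‖ ^ 2) / (2 * ε) =
          1 / (2 * ε) * (‖a - a'‖ ^ 2 + ‖b - b'‖ ^ 2) + ‖a - b‖ ^ 2 / (2 * ε) := by ring
        have v3 : 0 ≤ ‖a - b‖ ^ 2 / (2 * ε) := by positivity
        linarith
      have t4 : k * (‖a‖ ^ 2 + ‖b‖ ^ 2) ≤ β / 2 * (‖a‖ ^ 2 + ‖b‖ ^ 2) := by gcongr
      have t5 : k / 2 * ‖(((a, b), (a', b')) : (E × E) × (E × E))‖ ^ 2 ≤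
          k / 2 * (2 * (‖a‖ ^ 2 + ‖b‖ ^ 2 + ‖a - a'‖ ^ 2 + ‖b - b'‖ ^ 2)) := by gcongr
      have t6 : (‖p1‖ ^ 2 + ‖p2‖ ^ 2) / (2 * β) = ‖p1‖ ^ 2 / (2 * β) + ‖p2‖ ^ 2 / (2 * β) := add_div _ _ _
      rw [t6]
      linarith)
  refine ⟨x.1.1, x.1.2, x.2.1, x.2.2, hx.2.1, hx.2.2, fun c d c' hc' d' hd' => ?_⟩
  exact hm ((c, d), (c', d')) ⟨mem_univ _, hc', hd'⟩

theorem exists_innerB (E : Type*) [NormedAddCommGroup E] [InnerProductSpace ℝ E] :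
    ∃ B : E →L[ℝ] E →L[ℝ] ℝ, ∀ x y, B x y = ⟪x, y⟫ :=
  ⟨LinearMap.mkContinuous₂ (innerₗ E) 1 (fun x y => by
    rw [one_mul, innerₗ_apply_apply]; exact norm_inner_le_norm x y), fun x y => rfl⟩

theorem sums {E : Type*} [NormedAddCommGroup E] [InnerProductSpace ℝ E]
    [FiniteDimensional ℝ E] (D1 D2 : Set E) (hD1 : IsClosed D1) (hD2 : IsClosed D2)
    (hn1 : D1.Nonempty) (hn2 : D2.Nonempty) (u1 u2 : E → ℝ)
    (hc1 : ContinuousOn u1 D1) (hc2 : ContinuousOn u2 D2) (C : ℝ)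
    (hb1 : ∀ x ∈ D1, u1 x ≤ C) (hb2 : ∀ x ∈ D2, u2 x ≤ C) (ε β δ : ℝ) (hε : 0 < ε) (hβ : 0 < β)
    (hδ : 0 < δ) :
    ∃ (z w z' w' p1 p2 : E) (X Y : E →L[ℝ] E →L[ℝ] ℝ), z' ∈ D1 ∧ w' ∈ D2 ∧ ‖p1‖ ≤ δ ∧ ‖p2‖ ≤ δ ∧
      (∀ c d, ∀ c' ∈ D1, ∀ d' ∈ D2,
        Psi u1 u2 ε β p1 p2 c d c' d' ≤ Psi u1 u2 ε β p1 p2 z w z' w') ∧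
      (∀ c > 0, ∃ r > 0, ∀ η, ‖η‖ ≤ r → z' + η ∈ D1 →
        u1 (z' + η) ≤ u1 z' + ⟪(1 / ε) • (z - w) + (2 * β) • z + p1, η⟫ + X η η / 2
          + c * ‖η‖ ^ 2) ∧
      (∀ c > 0, ∃ r > 0, ∀ η, ‖η‖ ≤ r → w' + η ∈ D2 →
        u2 (w' + η) ≤ u2 w' + ⟪(1 / ε) • (w - z) + (2 * β) • w + p2, η⟫ + Y η η / 2
          + c * ‖η‖ ^ 2) ∧
      (∀ η1 η2, X η1 η1 + Y η2 η2 ≤ ‖η1 - η2‖ ^ 2 / ε + 2 * β * (‖η1‖ ^ 2 + ‖η2‖ ^ 2)) := by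
  haveI : ProperSpace E := FiniteDimensional.proper ℝ E
  have hsc : ∀ (D : Set E) (u : E → ℝ), IsClosed D → D.Nonempty → ContinuousOn u D →
      (∀ x ∈ D, u x ≤ C) → ∀ z, ∃ z' ∈ D, ∀ a' ∈ D,
        u a' - ‖z - a'‖ ^ 2 / (2 * ε) ≤ u z' - ‖z - z'‖ ^ 2 / (2 * ε) := by
    intro D u hD hn hc hb z
    refine attain D hD hn (fun a' => u a' - ‖z - a'‖ ^ 2 / (2 * ε)) (by fun_prop) C (1 / (2 * ε)) z
      (by positivity) fun x hx => ?_
    have := hb x hx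
    rw [norm_sub_rev z x, div_eq_mul_one_div, mul_comm]
    linarith
  choose m1 hm1 hM1 using hsc D1 u1 hD1 hn1 hc1 hb1
  choose m2 hm2 hM2 using hsc D2 u2 hD2 hn2 hc2 hb2
  set a1 : E → ℝ := fun z => u1 (m1 z) - ‖z - m1 z‖ ^ 2 / (2 * ε) with ha1
  set a2 : E → ℝ := fun z => u2 (m2 z) - ‖z - m2 z‖ ^ 2 / (2 * ε) with ha2
  set f : E × E → ℝ := fun ζ => a1 ζ.1 + a2 ζ.2 - ‖ζ.1 - ζ.2‖ ^ 2 / (2 * ε)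
    - β * (‖ζ.1‖ ^ 2 + ‖ζ.2‖ ^ 2) with hf
  have hPf : ∀ p1 p2 a b, ∀ a' ∈ D1, ∀ b' ∈ D2, Psi u1 u2 ε β p1 p2 a b a' b' ≤
      f (a, b) - ⟪p1, a⟫ - ⟪p2, b⟫ := by
    intro p1 p2 a b a' ha' b' hb'
    have h1 := hM1 a a' ha'
    have h2 := hM2 b b' hb'
    simp only [Psi, hf, ha1, ha2]
    rw [add_div, add_div]
    linarith
  have hPf' : ∀ p1 p2 a b, Psi u1 u2 ε β p1 p2 a b (m1 a) (m2 b) =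
      f (a, b) - ⟪p1, a⟫ - ⟪p2, b⟫ := by
    intro p1 p2 a b
    simp only [Psi, hf, ha1, ha2]
    rw [add_div, add_div]
    ring
  have hrep : ∀ p : E × E →L[ℝ] ℝ, ∃ p1 p2 : E, ‖p1‖ ≤ ‖p‖ ∧ ‖p2‖ ≤ ‖p‖ ∧
      ∀ a b, p (a, b) = ⟪p1, a⟫ + ⟪p2, b⟫ := by
    intro p
    refine ⟨(InnerProductSpace.toDual ℝ E).symm (p.comp (ContinuousLinearMap.inl ℝ E E)),
      (InnerProductSpace.toDual ℝ E).symm (p.comp (ContinuousLinearMap.inr ℝ E E)), ?_, ?_, ?_⟩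
    · rw [LinearIsometryEquiv.norm_map]
      refine ContinuousLinearMap.opNorm_le_bound _ (norm_nonneg p) fun x => ?_
      refine (p.le_opNorm _).trans ?_
      gcongr
      simp [Prod.norm_def]
    · rw [LinearIsometryEquiv.norm_map]
      refine ContinuousLinearMap.opNorm_le_bound _ (norm_nonneg p) fun x => ?_
      refine (p.le_opNorm _).trans ?_
      gcongr
      simp [Prod.norm_def]
    · intro a b
      rw [InnerProductSpace.toDual_symm_apply, InnerProductSpace.toDual_symm_apply]
      simp only [ContinuousLinearMap.comp_apply, ContinuousLinearMap.inl_apply,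
        ContinuousLinearMap.inr_apply]
      rw [← map_add]
      simp
  obtain ⟨⟨z, w⟩, p, M, hp, hcon, hexp⟩ := jensen_alex f (3 / ε + 2 * β) (by positivity) (by
      rintro ⟨z, w⟩
      set c1 : E := -(1 / ε) • (z - m1 z) - (1 / ε) • (z - w) - (2 * β) • z with hc1'
      set c2 : E := -(1 / ε) • (w - m2 w) - (1 / ε) • (w - z) - (2 * β) • w with hc2'
      refine ⟨(innerSL ℝ c1).comp (ContinuousLinearMap.fst ℝ E E)
        + (innerSL ℝ c2).comp (ContinuousLinearMap.snd ℝ E E), ?_⟩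
      rintro ⟨x, y⟩
      obtain ⟨v1, rfl⟩ : ∃ v, x = z + v := ⟨x - z, by abel⟩
      obtain ⟨v2, rfl⟩ : ∃ v, y = w + v := ⟨y - w, by abel⟩
      have h1 := hM1 (z + v1) (m1 z) (hm1 z)
      have h2 := hM2 (w + v2) (m2 w) (hm2 w)
      have hv : ((z + v1, w + v2) : E × E) - (z, w) = (v1, v2) := by simp
      rw [hv]
      have n1 : ‖v1‖ ≤ ‖(v1, v2)‖ := norm_fst_le (v1, v2)
      have n2 : ‖v2‖ ≤ ‖(v1, v2)‖ := norm_snd_le (v1, v2)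
      have n1' : ‖v1‖ ^ 2 ≤ ‖(v1, v2)‖ ^ 2 := by gcongr
      have n2' : ‖v2‖ ^ 2 ≤ ‖(v1, v2)‖ ^ 2 := by gcongr
      have n3 : ‖v1 - v2‖ ^ 2 ≤ 4 * ‖(v1, v2)‖ ^ 2 := by
        have : ‖v1 - v2‖ ≤ 2 * ‖(v1, v2)‖ := (norm_sub_le _ _).trans (by linarith)
        calc _ ≤ (2 * ‖(v1, v2)‖) ^ 2 := by gcongr
          _ = _ := by ring
      have x1 : ‖z + v1 - m1 z‖ ^ 2 = ‖z - m1 z‖ ^ 2 + 2 * ⟪z - m1 z, v1⟫ + ‖v1‖ ^ 2 := by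
        rw [← norm_add_sq_real]; congr 2; abel
      have x2 : ‖w + v2 - m2 w‖ ^ 2 = ‖w - m2 w‖ ^ 2 + 2 * ⟪w - m2 w, v2⟫ + ‖v2‖ ^ 2 := by
        rw [← norm_add_sq_real]; congr 2; abel
      have x3 : ‖z + v1 - (w + v2)‖ ^ 2 = ‖z - w‖ ^ 2 + 2 * ⟪z - w, v1 - v2⟫ + ‖v1 - v2‖ ^ 2 := by
        rw [← norm_add_sq_real]; congr 2; abel
      simp only [hf, ha1, ha2] at h1 h2 ⊢
      rw [x1] at h1
      rw [x2] at h2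
      rw [x3, norm_add_sq_real z, norm_add_sq_real w]
      simp only [_root_.add_apply, ContinuousLinearMap.comp_apply, ContinuousLinearMap.coe_fst',
        ContinuousLinearMap.coe_snd', innerSL_apply_apply, hc1', hc2', inner_sub_left,
        inner_smul_left, inner_sub_right, inner_neg_left, neg_smul] at h1 h2 ⊢
      simp only [conj_trivial]
      have k1 : ‖v1‖ ^ 2 / (2 * ε) ≤ ‖(v1, v2)‖ ^ 2 / (2 * ε) := by gcongr
      have k2 : ‖v2‖ ^ 2 / (2 * ε) ≤ ‖(v1, v2)‖ ^ 2 / (2 * ε) := by gcongr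
      have k3 : ‖v1 - v2‖ ^ 2 / (2 * ε) ≤ 4 * ‖(v1, v2)‖ ^ 2 / (2 * ε) := by gcongr
      have k4 : β * (‖v1‖ ^ 2 + ‖v2‖ ^ 2) ≤ β * (2 * ‖(v1, v2)‖ ^ 2) := by gcongr; linarith
      set I := (2 * ε)⁻¹ with hI
      have hI2 : 1 / ε = 2 * I := by rw [hI]; field_simp
      have hI3 : 3 / ε = 6 * I := by rw [hI]; field_simp; norm_num
      simp only [div_eq_mul_inv _ (2 * ε), ← hI] at h1 h2 k1 k2 k3 ⊢
      rw [hI2, hI3]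
      have := real_inner_comm z w
      linarith) δ hδ (by
      intro p hp
      obtain ⟨p1, p2, -, -, hpp⟩ := hrep p
      obtain ⟨a, b, a', b', ha', hb', hm⟩ := psi_attain D1 D2 hD1 hD2 hn1 hn2 u1 u2 hc1 hc2 C hb1 hb2
        ε β hε hβ p1 p2
      refine ⟨(a, b), ?_⟩
      rintro ⟨x, y⟩
      have h1 := hm x y (m1 x) (hm1 x) (m2 y) (hm2 y)
      rw [hPf'] at h1
      have h2 := hPf p1 p2 a b a' ha' b' hb'
      rw [hpp, hpp]
      linarith)
  obtain ⟨p1, p2, hp1, hp2, hpp⟩ := hrep p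
  obtain ⟨IB, hIB⟩ := exists_innerB E
  set IL := ContinuousLinearMap.inl ℝ E E with hIL
  set IR := ContinuousLinearMap.inr ℝ E E with hIR
  set X : E →L[ℝ] E →L[ℝ] ℝ := M.bilinearComp IL IL + (1 / ε + 2 * β) • IB with hX
  set Y : E →L[ℝ] E →L[ℝ] ℝ := M.bilinearComp IR IR + (1 / ε + 2 * β) • IB with hY
  have hXv : ∀ η, X η η = M (η, 0) (η, 0) + (1 / ε + 2 * β) * ‖η‖ ^ 2 := by
    intro η
    rw [← real_inner_self_eq_norm_sq]
    simp [hX, hIL, hIB]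
  have hYv : ∀ η, Y η η = M (0, η) (0, η) + (1 / ε + 2 * β) * ‖η‖ ^ 2 := by
    intro η
    rw [← real_inner_self_eq_norm_sq]
    simp [hY, hIR, hIB]
  refine ⟨z, w, m1 z, m2 w, p1, p2, X, Y, hm1 z, hm2 w, hp1.trans hp.le, hp2.trans hp.le, ?_, ?_, ?_,
    ?_⟩
  · intro c d c' hc' d' hd'
    rw [hPf']
    have h1 := hPf p1 p2 c d c' hc' d' hd'
    have h2 := hcon (c, d)
    rw [hpp, hpp] at h2
    linarith
  · intro c hc
    obtain ⟨r, hr, h⟩ := hexp c hc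
    refine ⟨r, hr, fun η hη hD => ?_⟩
    have h1 := (abs_le.1 (h (η, 0) (by simpa [Prod.norm_def] using hη))).2
    have h2 := hM1 (z + η) (m1 z + η) hD
    rw [hXv]
    rw [hpp, show ‖((η, 0) : E × E)‖ = ‖η‖ by simp [Prod.norm_def]] at h1
    simp only [hf, ha1, Prod.mk_add_mk, add_zero, inner_zero_right] at h1 h2
    rw [show z + η - (m1 z + η) = z - m1 z by abel] at h2
    rw [show z + η - w = (z - w) + η by abel, norm_add_sq_real, norm_add_sq_real] at h1
    rw [inner_add_left, inner_add_left, inner_smul_left, inner_smul_left]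
    simp only [conj_trivial]
    set I := (2 * ε)⁻¹ with hI
    have hI2 : 1 / ε = 2 * I := by rw [hI]; field_simp
    simp only [div_eq_mul_inv _ (2 * ε), ← hI] at h1 h2 ⊢
    rw [hI2]
    linarith
  · intro c hc
    obtain ⟨r, hr, h⟩ := hexp c hc
    refine ⟨r, hr, fun η hη hD => ?_⟩
    have h1 := (abs_le.1 (h (0, η) (by simpa [Prod.norm_def] using hη))).2
    have h2 := hM2 (w + η) (m2 w + η) hD
    rw [hYv]
    rw [hpp, show ‖((0, η) : E × E)‖ = ‖η‖ by simp [Prod.norm_def]] at h1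
    simp only [hf, ha2, Prod.mk_add_mk, add_zero, inner_zero_right] at h1 h2
    rw [show w + η - (m2 w + η) = w - m2 w by abel] at h2
    rw [norm_sub_rev z (w + η), norm_sub_rev z w,
      show w + η - z = (w - z) + η by abel, norm_add_sq_real, norm_add_sq_real] at h1
    rw [inner_add_left, inner_add_left, inner_smul_left, inner_smul_left]
    simp only [conj_trivial]
    set I := (2 * ε)⁻¹ with hI
    have hI2 : 1 / ε = 2 * I := by rw [hI]; field_simp
    simp only [div_eq_mul_inv _ (2 * ε), ← hI] at h1 h2 ⊢
    rw [hI2]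
    linarith
  · intro η1 η2
    rw [hXv, hYv]
    have key : ∀ c > 0, M (η1, 0) (η1, 0) / 2 + M (0, η2) (0, η2) / 2 + ⟪η1, η2⟫ / ε ≤
        c * (‖η1‖ ^ 2 + ‖η2‖ ^ 2) := by
      intro c hc
      obtain ⟨r, hr, h⟩ := hexp c hc
      set s := r / (1 + ‖η1‖ + ‖η2‖) with hs
      have hs0 : 0 < s := by positivity
      have hsr : s * (1 + ‖η1‖ + ‖η2‖) = r := by rw [hs]; field_simp
      have b1 : ‖s • η1‖ ≤ r := by
        rw [norm_smul, Real.norm_of_nonneg hs0.le, ← hsr]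
        gcongr; linarith [norm_nonneg η2]
      have b2 : ‖s • η2‖ ≤ r := by
        rw [norm_smul, Real.norm_of_nonneg hs0.le, ← hsr]
        gcongr; linarith [norm_nonneg η1]
      have h1 := (abs_le.1 (h (s • η1, 0) (by simpa [Prod.norm_def] using b1))).1
      have h2 := (abs_le.1 (h (0, s • η2) (by simpa [Prod.norm_def] using b2))).1
      have h3 := hcon (z + s • η1, w + s • η2)
      have e1 : M (s • η1, 0) (s • η1, 0) = s ^ 2 * M (η1, 0) (η1, 0) := by
        rw [show ((s • η1, 0) : E × E) = s • (η1, 0) by simp, map_smul, map_smul, _root_.smul_apply,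
          smul_eq_mul, smul_eq_mul]; ring
      have e2 : M (0, s • η2) (0, s • η2) = s ^ 2 * M (0, η2) (0, η2) := by
        rw [show ((0, s • η2) : E × E) = s • (0, η2) by simp, map_smul, map_smul, _root_.smul_apply,
          smul_eq_mul, smul_eq_mul]; ring
      rw [e1, hpp, show ‖((s • η1, 0) : E × E)‖ = s * ‖η1‖ by
        simp [Prod.norm_def, norm_smul, abs_of_pos hs0, hs0.le, mul_nonneg]] at h1
      rw [e2, hpp, show ‖((0, s • η2) : E × E)‖ = s * ‖η2‖ by
        simp [Prod.norm_def, norm_smul, abs_of_pos hs0, hs0.le, mul_nonneg]] at h2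
      rw [hpp, hpp] at h3
      simp only [hf, Prod.mk_add_mk, add_zero, inner_zero_right, inner_add_right, zero_add] at h1 h2 h3
      have y1 : ‖z + s • η1 - w‖ ^ 2 = ‖z - w‖ ^ 2 + 2 * (s * ⟪z - w, η1⟫) + ‖s • η1‖ ^ 2 := by
        rw [← real_inner_smul_right, ← norm_add_sq_real]; congr 2; abel
      have y2 : ‖z - (w + s • η2)‖ ^ 2 = ‖z - w‖ ^ 2 - 2 * (s * ⟪z - w, η2⟫) + ‖s • η2‖ ^ 2 := by
        rw [← real_inner_smul_right, ← norm_sub_sq_real]; congr 2; abel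
      have y3 : ‖z + s • η1 - (w + s • η2)‖ ^ 2 = ‖z - w‖ ^ 2 + 2 * (s * ⟪z - w, η1⟫ -
          s * ⟪z - w, η2⟫) + (‖s • η1‖ ^ 2 - 2 * (s ^ 2 * ⟪η1, η2⟫) + ‖s • η2‖ ^ 2) := by
        rw [show z + s • η1 - (w + s • η2) = (z - w) + (s • η1 - s • η2) by abel,
          norm_add_sq_real (z - w), norm_sub_sq_real (s • η1), inner_sub_right, real_inner_smul_right,
          real_inner_smul_right, real_inner_smul_left, real_inner_smul_right]
        ring
      rw [y1] at h1
      rw [y2] at h2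
      rw [y3] at h3
      have y4 : ⟪η1, η2⟫ / ε = 2 * ⟪η1, η2⟫ * (2 * ε)⁻¹ := by field_simp
      have fin : s ^ 2 * (M (η1, 0) (η1, 0) / 2 + M (0, η2) (0, η2) / 2 + ⟪η1, η2⟫ / ε) ≤
        s ^ 2 * (c * (‖η1‖ ^ 2 + ‖η2‖ ^ 2)) := by
        rw [y4]
        simp only [div_eq_mul_inv _ (2 * ε)] at h1 h2 h3
        linarith
      exact le_of_mul_le_mul_left fin (by positivity)
    have key2 : M (η1, 0) (η1, 0) / 2 + M (0, η2) (0, η2) / 2 + ⟪η1, η2⟫ / ε ≤ 0 := by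
      refine le_of_forall_pos_le_add fun e he => ?_
      have hd : 0 < 1 + ‖η1‖ ^ 2 + ‖η2‖ ^ 2 := by positivity
      refine (key (e / (1 + ‖η1‖ ^ 2 + ‖η2‖ ^ 2)) (by positivity)).trans ?_
      rw [zero_add, div_mul_eq_mul_div, div_le_iff₀ hd]
      nlinarith
    rw [norm_sub_sq_real]
    have : (‖η1‖ ^ 2 - 2 * ⟪η1, η2⟫ + ‖η2‖ ^ 2) / ε = 1 / ε * ‖η1‖ ^ 2 + 1 / ε * ‖η2‖ ^ 2
      - 2 * (⟪η1, η2⟫ / ε) := by ring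
    rw [this]
    linarith

theorem bil_exp {V : Type*} [AddCommGroup V] [Module ℝ V] {d n : ℕ} (Q : V →ₗ[ℝ] V →ₗ[ℝ] ℝ)
    (e : Fin d → V) (S : Matrix (Fin d) (Fin n) ℝ) (Hs : Matrix (Fin d) (Fin d) ℝ)
    (hH : ∀ i j, Hs i j = (Q (e i) (e j) + Q (e j) (e i)) / 2) :
    Matrix.trace (S * S.transpose * Hs) =
      ∑ k, Q (∑ i, S i k • e i) (∑ i, S i k • e i) := by
  have h1 : Matrix.trace (S * S.transpose * Hs) = ∑ k, ∑ i, ∑ j, S i k * S j k * Hs i j := by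
    rw [Matrix.mul_assoc, Matrix.trace_mul_comm]
    have : ∀ i j, Hs i j = Hs j i := fun i j => by rw [hH, hH]; ring
    simp only [Matrix.trace, Matrix.diag, Matrix.mul_apply, Matrix.transpose_apply, Finset.sum_mul]
    refine Finset.sum_congr rfl fun k _ => Finset.sum_congr rfl fun i _ =>
      Finset.sum_congr rfl fun j _ => ?_
    rw [this i j]; ring
  rw [h1]
  refine Finset.sum_congr rfl fun k _ => ?_
  have h2 : Q (∑ i, S i k • e i) (∑ i, S i k • e i) = ∑ i, ∑ j, S i k * S j k * Q (e i) (e j) := by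
    simp only [map_sum, LinearMap.sum_apply, map_smul, LinearMap.smul_apply, smul_eq_mul,
      Finset.mul_sum]
    rw [Finset.sum_comm]
    refine Finset.sum_congr rfl fun i _ => Finset.sum_congr rfl fun j _ => by ring
  have h3 : ∑ i, ∑ j, S i k * S j k * Q (e i) (e j) = ∑ i, ∑ j, S i k * S j k * Q (e j) (e i) := by
    rw [Finset.sum_comm]
    refine Finset.sum_congr rfl fun i _ => Finset.sum_congr rfl fun j _ => by ring
  have h4 : ∑ i, ∑ j, S i k * S j k * Hs i j =
      (∑ i, ∑ j, S i k * S j k * Q (e i) (e j) + ∑ i, ∑ j, S i k * S j k * Q (e j) (e i)) / 2 := by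
    rw [← Finset.sum_add_distrib, Finset.sum_div]
    refine Finset.sum_congr rfl fun i _ => ?_
    rw [← Finset.sum_add_distrib, Finset.sum_div]
    refine Finset.sum_congr rfl fun j _ => ?_
    rw [hH]; ring
  rw [h4, ← h3, h2]; ring

/-- Column of a matrix as a Euclidean vector. -/
def colv {d n : ℕ} (S : Matrix (Fin d) (Fin n) ℝ) (k : Fin n) : Euc d :=
  WithLp.toLp 2 (fun i => S i k)

theorem colv_eq {d n : ℕ} (S : Matrix (Fin d) (Fin n) ℝ) (k : Fin n) :
    colv S k = ∑ i, S i k • EuclideanSpace.single i (1 : ℝ) := by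
  ext j
  simp [colv, Finset.sum_apply, Pi.single_apply]

theorem colv_norm {d n : ℕ} (S : Matrix (Fin d) (Fin n) ℝ) :
    ∑ k, ‖colv S k‖ ^ 2 = matFrobNorm S ^ 2 := by
  unfold matFrobNorm
  rw [Real.sq_sqrt (by positivity), Finset.sum_comm]
  refine Finset.sum_congr rfl fun k _ => ?_
  rw [EuclideanSpace.norm_sq_eq]
  simp [colv]

theorem colv_sub {d n : ℕ} (S S' : Matrix (Fin d) (Fin n) ℝ) (k : Fin n) :
    colv (S - S') k = colv S k - colv S' k := by
  ext j; simp [colv]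

/-- test function -/
def tf (d : ℕ) (ρ : ℝ → ℝ) (p : Euc d) (Q : (ℝ × Euc d) →L[ℝ] (ℝ × Euc d) →L[ℝ] ℝ) (t : ℝ) (x : Euc d)
    (z : ℝ × Euc d) : ℝ :=
  ρ z.1 + ⟪p, z.2 - x⟫ + Q (z - (t, x)) (z - (t, x)) / 2

theorem tf_contDiff (d : ℕ) (ρ : ℝ → ℝ) (hρ : ContDiff ℝ 2 ρ) (p : Euc d)
    (Q : (ℝ × Euc d) →L[ℝ] (ℝ × Euc d) →L[ℝ] ℝ) (t : ℝ) (x : Euc d) :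
    ContDiff ℝ 2 (tf d ρ p Q t x) := by
  unfold tf
  refine ContDiff.add (ContDiff.add (hρ.comp contDiff_fst) ?_) (ContDiff.div_const ?_ _)
  · exact ContDiff.inner ℝ contDiff_const (contDiff_snd.sub contDiff_const)
  · have h : ContDiff ℝ 2 (fun z : ℝ × Euc d => z - (t, x)) := contDiff_id.sub contDiff_const
    exact (Q.contDiff.comp h).clm_apply h

theorem tf_partial (d : ℕ) (ρ : ℝ → ℝ) (p : Euc d)
    (Q : (ℝ × Euc d) →L[ℝ] (ℝ × Euc d) →L[ℝ] ℝ) (t : ℝ) (x : Euc d) (i : Fin d) (s : ℝ) (y : Euc d) :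
    spacePartial d i (tf d ρ p Q t x) s y = p i +
      (Q (s - t, y - x) (0, EuclideanSpace.single i 1) +
        Q (0, EuclideanSpace.single i 1) (s - t, y - x)) / 2 := by
  unfold spacePartial tf
  have hf : HasFDerivAt (fun y : Euc d => ((s, y) - (t, x) : ℝ × Euc d))
      (ContinuousLinearMap.inr ℝ ℝ (Euc d)) y := by
    have := (hasFDerivAt_prodMk_right (𝕜 := ℝ) s y).sub_const (t, x)
    exact this
  have h2 := Q.hasFDerivAt_of_bilinear hf hf
  have h1 : HasFDerivAt (fun y : Euc d => ρ s + ⟪p, y - x⟫) (innerSL ℝ p) y := by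
    have := ((innerSL ℝ p).hasFDerivAt (x := y - x)).comp y ((hasFDerivAt_id y).sub_const x)
    exact this.const_add (ρ s)
  have h3 := h1.add (h2.const_mul (1 / 2))
  have h4 := h3.congr_of_eventuallyEq (f₁ := fun y : Euc d => ρ (s, y).1 + ⟪p, (s, y).2 - x⟫
     + Q ((s, y) - (t, x)) ((s, y) - (t, x)) / 2) (Eventually.of_forall fun y => by
      simp only [Pi.add_apply]
      ring)
  rw [h4.fderiv]
  simp [EuclideanSpace.inner_single_right]
  ring

theorem tf_hess (d : ℕ) (ρ : ℝ → ℝ) (p : Euc d)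
    (Q : (ℝ × Euc d) →L[ℝ] (ℝ × Euc d) →L[ℝ] ℝ) (t : ℝ) (x : Euc d) (i j : Fin d) :
    spaceHessian d (tf d ρ p Q t x) t x i j =
      (Q (0, EuclideanSpace.single i 1) (0, EuclideanSpace.single j 1) +
        Q (0, EuclideanSpace.single j 1) (0, EuclideanSpace.single i 1)) / 2 := by
  unfold spaceHessian
  simp only [Matrix.of_apply, tf_partial]
  unfold spacePartial
  set e : ℝ × Euc d := (0, EuclideanSpace.single j 1)
  set L : Euc d →L[ℝ] ℝ := (1 / 2 : ℝ) • ((Q.flip e + Q e).comp (ContinuousLinearMap.inr ℝ ℝ (Euc d)))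
    with hL
  have h : HasFDerivAt (fun y : Euc d => p j + (Q (t - t, y - x) e + Q e (t - t, y - x)) / 2) L x := by
    have := (L.hasFDerivAt (x := x - x)).comp (f := fun y => y - x) x ((hasFDerivAt_id x).sub_const x)
    have := this.const_add (p j)
    refine this.congr_of_eventuallyEq (Eventually.of_forall fun y => ?_)
    simp [hL]
    ring
  rw [h.fderiv]
  simp [hL]
  ring

theorem tf_op (d : ℕ) (A : Euc d → Matrix (Fin d) (Fin d) ℝ) (H : Euc d → Euc d → ℝ) {n : ℕ}
    (S : Matrix (Fin d) (Fin n) ℝ) (ρ : ℝ → ℝ) (hρ : ContDiff ℝ 2 ρ) (p : Euc d)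
    (Q : (ℝ × Euc d) →L[ℝ] (ℝ × Euc d) →L[ℝ] ℝ) (t : ℝ) (x : Euc d)
    (hS : A x = S * S.transpose) :
    parabolicOp d A H (tf d ρ p Q t x) t x =
      deriv ρ t - ∑ k, Q (0, colv S k) (0, colv S k) + H x p := by
  unfold parabolicOp
  have h1 : timeDeriv d (tf d ρ p Q t x) t x = deriv ρ t := by
    unfold timeDeriv tf
    have hf : HasDerivAt (fun s : ℝ => ((s, x) - (t, x) : ℝ × Euc d)) (1, 0) t := by
      have := ((hasDerivAt_id t).prodMk (hasDerivAt_const t x)).sub_const (t, x)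
      exact this
    have h2 := (Q.hasFDerivAt.comp_hasDerivAt t hf).clm_apply hf
    have h0 := (hρ.differentiable (by norm_num)).differentiableAt (x := t) |>.hasDerivAt
    have h3 := h0.add (h2.const_mul (1 / 2))
    have h4 := HasDerivAt.congr_of_eventuallyEq (f₁ := fun s => ρ (s, x).1 + ⟪p, (s, x).2 - x⟫
     + Q ((s, x) - (t, x)) ((s, x) - (t, x)) / 2) h3 (Eventually.of_forall fun s => by
      simp; ring)
    rw [h4.deriv]
    simp [show (((0 : ℝ), (0 : Euc d)) : ℝ × Euc d) = 0 from rfl]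
  have h2 : spaceGrad d (tf d ρ p Q t x) t x = p := by
    unfold spaceGrad
    ext i
    simp [tf_partial, EuclideanSpace.equiv, show (((0 : ℝ), (0 : Euc d)) : ℝ × Euc d) = 0 from rfl]
  rw [h1, h2, hS]
  have h3 := bil_exp (V := ℝ × Euc d) (Q.toLinearMap₁₂) (fun i => (0, EuclideanSpace.single i (1:ℝ))) S
    (spaceHessian d (tf d ρ p Q t x) t x) (fun i j => tf_hess d ρ p Q t x i j)
  rw [h3]
  congr 2
  refine Finset.sum_congr rfl fun k _ => ?_
  have : ((0, colv S k) : ℝ × Euc d) = ∑ i, S i k • ((0 : ℝ), EuclideanSpace.single i (1:ℝ)) := by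
    rw [colv_eq]
    simp [Prod.ext_iff, Prod.fst_sum, Prod.snd_sum]
  rw [this]
  rfl

theorem visc_jet (d : ℕ) (A : Euc d → Matrix (Fin d) (Fin d) ℝ) (H : Euc d → Euc d → ℝ) (T : ℝ)
    (u : ℝ × Euc d → ℝ) (hu : IsViscSubsolution d A H T univ u) {n : ℕ}
    (S : Matrix (Fin d) (Fin n) ℝ) (ρ : ℝ → ℝ) (hρ : ContDiff ℝ 2 ρ) (p : Euc d)
    (Q : (ℝ × Euc d) →L[ℝ] (ℝ × Euc d) →L[ℝ] ℝ) (t : ℝ) (ht : t ∈ Ioo 0 T) (x : Euc d)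
    (hS : A x = S * S.transpose)
    (h : ∀ c > 0, ∃ r > 0, ∀ τ ξ, |τ| ≤ r → ‖ξ‖ ≤ r → t + τ ∈ Ioo 0 T →
      u (t + τ, x + ξ) ≤ u (t, x) + ρ (t + τ) - ρ t + ⟪p, ξ⟫ + Q (τ, ξ) (τ, ξ) / 2
        + c * (τ ^ 2 + ‖ξ‖ ^ 2)) :
    deriv ρ t - ∑ k, Q (0, colv S k) (0, colv S k) + H x p ≤ 0 := by
  obtain ⟨IB, hIB⟩ := exists_innerB (Euc d)
  obtain ⟨IR, hIR⟩ := exists_innerB ℝ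
  set N : ℝ × Euc d →L[ℝ] ℝ × Euc d →L[ℝ] ℝ :=
    IB.bilinearComp (ContinuousLinearMap.snd ℝ ℝ (Euc d)) (ContinuousLinearMap.snd ℝ ℝ (Euc d)) +
    IR.bilinearComp (ContinuousLinearMap.fst ℝ ℝ (Euc d)) (ContinuousLinearMap.fst ℝ ℝ (Euc d)) with hN
  have hNv : ∀ τ ξ, N (τ, ξ) (τ, ξ) = τ ^ 2 + ‖ξ‖ ^ 2 := by
    intro τ ξ
    simp [hN, hIB, hIR, add_comm]
  have key : ∀ c > 0, deriv ρ t - ∑ k, Q (0, colv S k) (0, colv S k) + H x p ≤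
      c * (2 * ∑ k, ‖colv S k‖ ^ 2) := by
    intro c hc
    obtain ⟨r, hr, hr'⟩ := h c hc
    have h1 := hu (tf d ρ p (Q + (2 * c) • N) t x) (tf_contDiff d ρ hρ p _ t x) t ht x (mem_univ _) (by
      have hnb : ball ((t, x) : ℝ × Euc d) r ∈ nhdsWithin (t, x) (Ioo 0 T ×ˢ univ) :=
        mem_nhdsWithin_of_mem_nhds (ball_mem_nhds _ hr)
      filter_upwards [hnb, self_mem_nhdsWithin] with z hz hz2
      obtain ⟨s, y⟩ := z
      obtain ⟨τ, rfl⟩ : ∃ τ, s = t + τ := ⟨s - t, by ring⟩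
      obtain ⟨ξ, rfl⟩ : ∃ ξ, y = x + ξ := ⟨y - x, by abel⟩
      rw [mem_ball, Prod.dist_eq, max_lt_iff] at hz
      simp only [dist_self_add_left, Real.norm_eq_abs] at hz
      have h2 := hr' τ ξ hz.1.le hz.2.le hz2.1
      have hz0 : ((t + τ, x + ξ) : ℝ × Euc d) - (t, x) = (τ, ξ) := by simp
      simp only [tf, hz0, sub_self, add_sub_cancel_left, inner_zero_right, map_zero, _root_.add_apply,
        _root_.smul_apply, hNv, smul_eq_mul]
      linarith)
    rw [tf_op d A H S ρ hρ p _ t x hS] at h1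
    simp only [_root_.add_apply, _root_.smul_apply, hNv, smul_eq_mul, Finset.sum_add_distrib,
      ← Finset.mul_sum] at h1
    simp only [ne_eq, OfNat.ofNat_ne_zero, not_false_eq_true, zero_pow, zero_add, Finset.sum_const_zero] at h1
    linarith
  have hD : 0 ≤ 2 * ∑ k, ‖colv S k‖ ^ 2 := by positivity
  refine le_of_forall_pos_le_add fun e he => ?_
  refine (key (e / (1 + 2 * ∑ k, ‖colv S k‖ ^ 2)) (by positivity)).trans ?_
  rw [zero_add, div_mul_eq_mul_div, div_le_iff₀ (by positivity)]
  nlinarith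

theorem super_neg (d : ℕ) (A : Euc d → Matrix (Fin d) (Fin d) ℝ) (H : Euc d → Euc d → ℝ) (T : ℝ)
    (u : ℝ × Euc d → ℝ) (hu : IsViscSupersolution d A H T univ u) :
    IsViscSubsolution d A (fun x p => - H x (-p)) T univ (fun z => - u z) := by
  intro φ hφ t ht x hx hm
  have h := hu (fun z => - φ z) hφ.neg t ht x hx (by
    filter_upwards [hm] with z hz
    linarith)
  have hp : ∀ (ψ : ℝ × Euc d → ℝ) i s y, spacePartial d i (fun z => - ψ z) s y = - spacePartial d i ψ s y := by
    intro ψ i s y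
    unfold spacePartial
    rw [fderiv_fun_neg]; rfl
  have e1 : timeDeriv d (fun z => - φ z) t x = - timeDeriv d φ t x := by
    unfold timeDeriv
    rw [deriv.fun_neg]
  have e2 : spaceGrad d (fun z => - φ z) t x = - spaceGrad d φ t x := by
    unfold spaceGrad
    ext i
    simp [hp]
  have e3 : spaceHessian d (fun z => - φ z) t x = - spaceHessian d φ t x := by
    unfold spaceHessian
    ext i j
    simp only [Matrix.of_apply, Matrix.neg_apply, hp]
  unfold parabolicOp at h ⊢
  rw [e1, e2, e3, Matrix.mul_neg, Matrix.trace_neg] at h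
  linarith

theorem sub_neg' (d : ℕ) (A : Euc d → Matrix (Fin d) (Fin d) ℝ) (H : Euc d → Euc d → ℝ) (T : ℝ)
    (u : ℝ × Euc d → ℝ) (hu : IsViscSubsolution d A H T univ u) :
    IsViscSubsolution d A (fun x p => - (fun x p => - H x (-p)) x (-p)) T univ (fun z => - (- u z)) := by
  simpa using hu

theorem extend_right (T : ℝ) (hT : 0 < T) (f : ℝ → ℝ) (hf : ContinuousOn f (Icc 0 T)) (b : ℝ)
    (h : ∀ t ∈ Ico 0 T, f t ≤ b) : ∀ t ∈ Icc 0 T, f t ≤ b := by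
  intro t ht
  rcases lt_or_eq_of_le ht.2 with h1 | h1
  · exact h t ⟨ht.1, h1⟩
  · subst h1
    have h2 : ContinuousWithinAt f (Ico 0 t) t := (hf t ht).mono Ico_subset_Icc_self
    have h3 : t ∈ closure (Ico 0 t) := by
      rw [closure_Ico hT.ne]; exact ht
    exact h2.closure_le h3 continuousWithinAt_const h

theorem exp_small (t0 T m θ : ℝ) (h : t0 < T) (hθ : 0 < θ) :
    ∃ k : ℝ, 0 ≤ k ∧ m * Real.exp (k * (t0 - T)) ≤ θ := by
  have h1 : Tendsto (fun k : ℝ => m * Real.exp (k * (t0 - T))) atTop (nhds (m * 0)) := by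
    refine Tendsto.const_mul m (Real.tendsto_exp_atBot.comp ?_)
    exact tendsto_id.atTop_mul_const_of_neg (by linarith)
  rw [mul_zero] at h1
  have h2 := (h1.eventually (gt_mem_nhds hθ)).and (eventually_ge_atTop 0)
  obtain ⟨k, hk, hk0⟩ := h2.exists
  exact ⟨k, hk0, hk.le⟩

/-- time part of the test functions -/
def rho (κ m k T t : ℝ) : ℝ := κ * t + m * Real.exp (k * (t - T))

theorem rho_contDiff (κ m k T : ℝ) : ContDiff ℝ 2 (rho κ m k T) := by
  unfold rho
  fun_prop

theorem rho_deriv (κ m k T t : ℝ) (hm : 0 ≤ m) (hk : 0 ≤ k) : κ ≤ deriv (rho κ m k T) t := by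
  have h : HasDerivAt (rho κ m k T) (κ * 1 + m * (Real.exp (k * (t - T)) * (k * 1))) t := by
    unfold rho
    exact ((hasDerivAt_id t).const_mul κ).add
      ((((hasDerivAt_id t).sub_const T).const_mul k).exp.const_mul m)
  rw [h.deriv]
  have : 0 ≤ m * (Real.exp (k * (t - T)) * (k * 1)) := by positivity
  linarith

theorem condA_col {d n : ℕ} (S : Matrix (Fin d) (Fin n) ℝ) (b : ℝ) (h : matFrobNorm S ≤ b) :
    ∑ k, ‖colv S k‖ ^ 2 ≤ b ^ 2 := by
  rw [colv_norm]
  have : 0 ≤ matFrobNorm S := Real.sqrt_nonneg _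
  gcongr

theorem stepC (d : ℕ) (A : Euc d → Matrix (Fin d) (Fin d) ℝ) (H : Euc d → Euc d → ℝ) (T : ℝ)
    (hT : 0 < T) (Λ : ℝ) (hA : CondA d Λ A)
    (u : ℝ × Euc d → ℝ) (hc : ContinuousOn u (Icc 0 T ×ˢ univ)) (C : ℝ)
    (hb : ∀ t ∈ Icc 0 T, ∀ x, |u (t, x)| ≤ C) (hu : IsViscSubsolution d A H T univ u)
    (g : Euc d → ℝ) (hg : Continuous g) (hgb : ∀ x, |g x| ≤ C) (h0 : ∀ x, u (0, x) ≤ g x)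
    (L a c κ : ℝ) (ha : 0 ≤ a)
    (hsemi : ∀ x0, ∃ p : Euc d, ‖p‖ ≤ L ∧ ∀ x, g x ≤ g x0 + ⟪p, x - x0⟫ + a / 2 * ‖x - x0‖ ^ 2)
    (hH : ∀ x p, ‖p‖ ≤ L + 1 → - c ≤ H x p) (hκ : c + a * Λ ^ 2 < κ) :
    ∀ t ∈ Icc 0 T, ∀ x, u (t, x) ≤ g x + κ * t := by
  suffices hmain : ∀ t ∈ Ico 0 T, ∀ x, u (t, x) ≤ g x + κ * t by
    intro t ht x
    have := extend_right T hT (fun t => u (t, x) - κ * t) (by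
      refine ContinuousOn.sub (hc.comp (by fun_prop) (fun t ht => ⟨ht, mem_univ _⟩)) (by fun_prop))
      (g x) (fun t ht => by have := hmain t ht x; linarith) t ht
    linarith
  intro t0 ht0 x0
  by_contra hcon
  push Not at hcon
  have ht0' : t0 ∈ Icc 0 T := ⟨ht0.1, ht0.2.le⟩
  have hC0 : 0 ≤ C := (abs_nonneg _).trans (hgb x0)
  obtain ⟨θ, hθ, hθ'⟩ : ∃ θ > 0, 3 * θ ≤ u (t0, x0) - g x0 - κ * t0 :=
    ⟨(u (t0, x0) - g x0 - κ * t0) / 3, by linarith, by linarith⟩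
  set C1 := 2 * C + |κ| * T with hC1
  have hC10 : 0 ≤ C1 := by positivity
  set m := C1 + 1 with hm
  have hm0 : 0 ≤ m := by positivity
  obtain ⟨k, hk0, hk⟩ := exp_small t0 T m θ ht0.2 hθ
  set e := κ - c - a * Λ ^ 2 with he
  have he0 : 0 < e := by linarith
  obtain ⟨β, hβ, hβ1, hβ2, hβ3⟩ : ∃ β > 0, β * ‖x0‖ ^ 2 ≤ θ ∧ 4 * β * C1 ≤ 1 ∧ 2 * β * Λ ^ 2 < e := by
    refine ⟨min (θ / (1 + ‖x0‖ ^ 2)) (min (1 / (1 + 4 * C1)) (e / (1 + 2 * Λ ^ 2))), by positivity,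
      ?_, ?_, ?_⟩
    · have h1 := min_le_left (θ / (1 + ‖x0‖ ^ 2)) (min (1 / (1 + 4 * C1)) (e / (1 + 2 * Λ ^ 2)))
      refine (mul_le_mul_of_nonneg_right h1 (by positivity)).trans ?_
      rw [div_mul_eq_mul_div, div_le_iff₀ (by positivity)]
      nlinarith
    · have h1 := (min_le_right (θ / (1 + ‖x0‖ ^ 2)) (min (1 / (1 + 4 * C1)) (e / (1 + 2 * Λ ^ 2)))).trans
        (min_le_left _ _)
      rw [le_div_iff₀ (by positivity)] at h1
      have : 0 < min (θ / (1 + ‖x0‖ ^ 2)) (min (1 / (1 + 4 * C1)) (e / (1 + 2 * Λ ^ 2))) := by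
        positivity
      nlinarith
    · have h1 := (min_le_right (θ / (1 + ‖x0‖ ^ 2)) (min (1 / (1 + 4 * C1)) (e / (1 + 2 * Λ ^ 2)))).trans
        (min_le_right _ _)
      rw [le_div_iff₀ (by positivity)] at h1
      have : 0 < min (θ / (1 + ‖x0‖ ^ 2)) (min (1 / (1 + 4 * C1)) (e / (1 + 2 * Λ ^ 2))) := by
        positivity
      nlinarith
  set F : ℝ × Euc d → ℝ := fun z => u z - g z.2 - β * ‖z.2‖ ^ 2 - rho κ m k T z.1 with hF
  have hrc := (rho_contDiff κ m k T).continuous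
  have hκt : ∀ t ∈ Icc 0 T, - (κ * t) ≤ |κ| * T := by
    intro t ht
    have h1 : |κ * t| ≤ |κ| * T := by
      rw [abs_mul, abs_of_nonneg ht.1]; gcongr; exact ht.2
    linarith [neg_abs_le (κ * t)]
  have hFb : ∀ t ∈ Icc 0 T, ∀ x, F (t, x) ≤ C1 - β * ‖x‖ ^ 2 := by
    intro t ht x
    have h1 := (abs_le.1 (hb t ht x)).2
    have h2 := (abs_le.1 (hgb x)).1
    have h3 := hκt t ht
    have h4 : 0 ≤ m * Real.exp (k * (t - T)) := by positivity
    simp only [hF, rho]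
    linarith
  obtain ⟨⟨t1, x1⟩, ⟨ht1, -⟩, hmax⟩ := attain (Icc 0 T ×ˢ (univ : Set (Euc d)))
    (isClosed_Icc.prod isClosed_univ) ⟨(t0, x0), ht0', mem_univ _⟩ F
    (((hc.sub (by fun_prop)).sub (by fun_prop)).sub (by fun_prop)) (C1 + β * T ^ 2) β 0 hβ (by
      rintro ⟨t, x⟩ ⟨ht, -⟩
      have h1 := hFb t ht x
      have h2 : ‖((t, x) : ℝ × Euc d)‖ ^ 2 ≤ T ^ 2 + ‖x‖ ^ 2 := by
        rw [Prod.norm_def]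
        simp only [Real.norm_eq_abs]
        have h4 : t ^ 2 ≤ T ^ 2 := pow_le_pow_left₀ ht.1 ht.2 2
        rcases max_choice |t| ‖x‖ with h | h <;> rw [h]
        · rw [sq_abs]; nlinarith [sq_nonneg ‖x‖]
        · nlinarith [sq_nonneg T]
      rw [sub_zero]
      nlinarith)
  simp only at ht1
  have hval : θ ≤ F (t1, x1) := by
    have h1 := hmax (t0, x0) ⟨ht0', mem_univ _⟩
    refine le_trans ?_ h1
    simp only [hF, rho]
    linarith
  have ht1a : 0 < t1 := by
    rcases lt_or_eq_of_le ht1.1 with h | h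
    · exact h
    · exfalso
      rw [← h] at hval
      simp only [hF, rho] at hval
      have h1 := h0 x1
      have h4 : 0 ≤ m * Real.exp (k * (0 - T)) := by positivity
      have h5 : 0 ≤ β * ‖x1‖ ^ 2 := by positivity
      linarith
  have ht1b : t1 < T := by
    rcases lt_or_eq_of_le ht1.2 with h | h
    · exact h
    · exfalso
      have h3 := hκt t1 ht1
      have h1 := (abs_le.1 (hb t1 ht1 x1)).2
      have h2 := (abs_le.1 (hgb x1)).1
      have h5 : 0 ≤ β * ‖x1‖ ^ 2 := by positivity
      simp only [hF, rho] at hval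
      rw [h] at hval h3 h1
      simp only [sub_self, mul_zero, Real.exp_zero, mul_one] at hval
      linarith
  have hx1 : ‖(2 * β) • x1‖ ≤ 1 := by
    have h1 := hFb t1 ht1 x1
    have h2 : ‖(2 * β) • x1‖ ^ 2 ≤ 1 ^ 2 := by
      rw [norm_smul, Real.norm_of_nonneg (by positivity), mul_pow]
      nlinarith
    exact (pow_le_pow_iff_left₀ (norm_nonneg _) zero_le_one two_ne_zero).1 h2
  obtain ⟨p, hp, hpg⟩ := hsemi x1
  obtain ⟨n, σ, hσ, hσb, -⟩ := hA
  obtain ⟨IB, hIB⟩ := exists_innerB (Euc d)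
  set Q : ℝ × Euc d →L[ℝ] ℝ × Euc d →L[ℝ] ℝ := (a + 2 * β) •
    IB.bilinearComp (ContinuousLinearMap.snd ℝ ℝ (Euc d)) (ContinuousLinearMap.snd ℝ ℝ (Euc d)) with hQ
  have hQv : ∀ τ ξ, Q (τ, ξ) (τ, ξ) = (a + 2 * β) * ‖ξ‖ ^ 2 := by
    intro τ ξ
    simp [hQ, hIB]
  have hv := visc_jet d A H T u hu (σ x1) (rho κ m k T) (rho_contDiff _ _ _ _) (p + (2 * β) • x1) Q t1
    ⟨ht1a, ht1b⟩ x1 (hσ x1) (by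
      intro c hc
      refine ⟨1, one_pos, fun τ ξ _ _ hτ => ?_⟩
      have h1 := hmax (t1 + τ, x1 + ξ) ⟨⟨hτ.1.le, hτ.2.le⟩, mem_univ _⟩
      have h2 := hpg (x1 + ξ)
      simp only [hF] at h1
      rw [norm_add_sq_real] at h1
      rw [add_sub_cancel_left] at h2
      rw [hQv, inner_add_left, real_inner_smul_left]
      have : 0 ≤ c * (τ ^ 2 + ‖ξ‖ ^ 2) := by positivity
      linarith)
  have hr := rho_deriv κ m k T t1 hm0 hk0
  have hh := hH x1 (p + (2 * β) • x1) ((norm_add_le _ _).trans (by linarith))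
  simp only [hQv, ← Finset.mul_sum] at hv
  have hs := condA_col _ _ (hσb x1)
  have : (a + 2 * β) * ∑ k, ‖colv (σ x1) k‖ ^ 2 ≤ (a + 2 * β) * Λ ^ 2 := by gcongr
  linarith

theorem g_semi {F : Type*} [NormedAddCommGroup F] [InnerProductSpace ℝ F] [CompleteSpace F]
    (g : F → ℝ) (L1 L2 : ℝ) (hL2 : 0 ≤ L2) (hg : Differentiable ℝ g)
    (h1 : ∀ x, ‖fderiv ℝ g x‖ ≤ L1)
    (h2 : ∀ x y, ‖fderiv ℝ g x - fderiv ℝ g y‖ ≤ L2 * ‖x - y‖) (x0 : F) :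
    ∃ p : F, ‖p‖ ≤ L1 ∧ ∀ x, |g x - g x0 - ⟪p, x - x0⟫| ≤ L2 * ‖x - x0‖ ^ 2 := by
  refine ⟨(InnerProductSpace.toDual ℝ F).symm (fderiv ℝ g x0), ?_, fun x => ?_⟩
  · rw [LinearIsometryEquiv.norm_map]; exact h1 x0
  · rw [InnerProductSpace.toDual_symm_apply]
    have := (convex_closedBall x0 ‖x - x0‖).norm_image_sub_le_of_norm_fderiv_le' (f := g) (𝕜 := ℝ)
      (φ := fderiv ℝ g x0) (C := L2 * ‖x - x0‖) (fun y _ => hg y) (fun y hy => by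
        refine (h2 y x0).trans ?_
        rw [mem_closedBall, dist_eq_norm] at hy
        gcongr) (x := x0) (y := x) (by simp) (by simp [dist_eq_norm])
    rw [Real.norm_eq_abs] at this
    refine this.trans (le_of_eq (by ring))

theorem small_ev (a b : ℝ) (hb : 0 < b) : ∀ᶠ β in nhdsWithin (0 : ℝ) (Ioi 0), β * a < b := by
  have h : Tendsto (fun β : ℝ => β * a) (nhds 0) (nhds (0 * a)) :=
    (continuous_id.mul continuous_const).tendsto 0
  rw [zero_mul] at h
  exact (h.eventually (gt_mem_nhds hb)).filter_mono nhdsWithin_le_nhds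

theorem stat_zero {E : Type*} [NormedAddCommGroup E] [InnerProductSpace ℝ E] (c : E) (k : ℝ)
    (hk : 0 ≤ k) (h : ∀ η, - ⟪c, η⟫ ≤ k * ‖η‖ ^ 2) : c = 0 := by
  have h1 := h (-((1 / (k + 1)) • c))
  have hk1 : 0 < k + 1 := by linarith
  rw [inner_neg_right, real_inner_smul_right, real_inner_self_eq_norm_sq, norm_neg, norm_smul,
    Real.norm_of_nonneg (by positivity)] at h1
  have h2 : k * (1 / (k + 1) * ‖c‖) ^ 2 = (k / (k + 1)) * (1 / (k + 1) * ‖c‖ ^ 2) := by ring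
  have h3 : 1 - k / (k + 1) = 1 / (k + 1) := by field_simp; ring
  have h4 : (1 / (k + 1)) * (1 / (k + 1) * ‖c‖ ^ 2) ≤ 0 := by
    rw [← h3]; rw [h2] at h1; rw [h3]
    have : (1 - k / (k + 1)) * (1 / (k + 1) * ‖c‖ ^ 2) ≤ 0 := by linarith
    rwa [h3] at this
  have h5 : ‖c‖ ^ 2 ≤ 0 := by
    by_contra hne
    push Not at hne
    have : 0 < (1 / (k + 1)) * (1 / (k + 1) * ‖c‖ ^ 2) := by positivity
    linarith
  have h6 : ‖c‖ = 0 := by nlinarith [sq_nonneg ‖c‖, norm_nonneg c]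
  exact norm_eq_zero.1 h6

theorem psi_stat {E : Type*} [NormedAddCommGroup E] [InnerProductSpace ℝ E] (u1 u2 : E → ℝ) (ε β : ℝ)
    (hε : 0 < ε) (hβ : 0 < β) (p1 p2 z w z' w' : E)
    (h1 : ∀ c, Psi u1 u2 ε β p1 p2 c w z' w' ≤ Psi u1 u2 ε β p1 p2 z w z' w') :
    (1 / ε) • (z - w) + (2 * β) • z + p1 = (1 / ε) • (z' - z) := by
  have : (1 / ε) • (z - z') + (1 / ε) • (z - w) + (2 * β) • z + p1 = 0 := by
    refine stat_zero _ (1 / ε + β) (by positivity) fun η => ?_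
    have h := h1 (z + η)
    unfold Psi at h
    rw [show z + η - z' = (z - z') + η by abel, show z + η - w = (z - w) + η by abel,
      norm_add_sq_real, norm_add_sq_real, norm_add_sq_real, inner_add_right] at h
    rw [inner_add_left, inner_add_left, inner_add_left, real_inner_smul_left, real_inner_smul_left,
      real_inner_smul_left]
    set I := (2 * ε)⁻¹ with hI
    have hI2 : 1 / ε = 2 * I := by rw [hI]; field_simp
    simp only [div_eq_mul_inv _ (2 * ε), ← hI] at h
    rw [hI2]
    linarith
  rw [← sub_eq_zero, ← this]
  module

theorem psi_stat2 {E : Type*} [NormedAddCommGroup E] [InnerProductSpace ℝ E] (u1 u2 : E → ℝ) (ε β : ℝ)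
    (hε : 0 < ε) (hβ : 0 < β) (p1 p2 z w z' w' : E)
    (h1 : ∀ c, Psi u1 u2 ε β p1 p2 z c z' w' ≤ Psi u1 u2 ε β p1 p2 z w z' w') :
    (1 / ε) • (w - z) + (2 * β) • w + p2 = (1 / ε) • (w' - w) := by
  refine psi_stat u2 u1 ε β hε hβ p2 p1 w z w' z' fun c => ?_
  have := h1 c
  unfold Psi at this ⊢
  rw [norm_sub_rev c z, norm_sub_rev w z]
  rw [show ‖c - w'‖ ^ 2 + ‖z - z'‖ ^ 2 + ‖z - c‖ ^ 2 = ‖z - z'‖ ^ 2 + ‖c - w'‖ ^ 2 + ‖z - c‖ ^ 2 by ring,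
    show ‖w - w'‖ ^ 2 + ‖z - z'‖ ^ 2 + ‖z - w‖ ^ 2 = ‖z - z'‖ ^ 2 + ‖w - w'‖ ^ 2 + ‖z - w‖ ^ 2 by ring]
  linarith

theorem psi_val {E : Type*} [NormedAddCommGroup E] [InnerProductSpace ℝ E] (u1 u2 : E → ℝ) (ε β θ : ℝ)
    (hβ : 0 < β) (p1 p2 z w z' w' z0 : E) (hp1 : ‖p1‖ ≤ β) (hp2 : ‖p2‖ ≤ β)
    (h : Psi u1 u2 ε β p1 p2 z0 z0 z0 z0 ≤ Psi u1 u2 ε β p1 p2 z w z' w')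
    (h0 : 2 * θ ≤ u1 z0 + u2 z0) (hs : β * (2 * ‖z0‖ ^ 2 + 2 * ‖z0‖ + 1) < θ) :
    θ + (‖z - z'‖ ^ 2 + ‖w - w'‖ ^ 2 + ‖z - w‖ ^ 2) / (2 * ε) + β / 2 * (‖z‖ ^ 2 + ‖w‖ ^ 2) ≤
      u1 z' + u2 w' := by
  have hin : ∀ p v : E, ‖p‖ ≤ β → |⟪p, v⟫| ≤ β * ‖v‖ := fun p v hp =>
    (abs_real_inner_le_norm p v).trans (by gcongr)
  have a1 := (abs_le.1 (hin p1 z0 hp1)).2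
  have a2 := (abs_le.1 (hin p2 z0 hp2)).2
  have a3 := (abs_le.1 (hin p1 z hp1)).1
  have a4 := (abs_le.1 (hin p2 w hp2)).1
  have hq : ∀ v : E, β * ‖v‖ ≤ β * (‖v‖ ^ 2 / 2 + 1 / 2) := fun v => by
    gcongr; nlinarith [sq_nonneg (‖v‖ - 1)]
  have b1 := hq z
  have b2 := hq w
  unfold Psi at h
  simp only [sub_self, norm_zero] at h
  norm_num at h
  nlinarith

theorem wl_norm {d : ℕ} (z : WithLp 2 (ℝ × Euc d)) : ‖z‖ ^ 2 = z.fst ^ 2 + ‖z.snd‖ ^ 2 := by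
  rw [WithLp.prod_norm_sq_eq_of_L2, Real.norm_eq_abs, sq_abs]

theorem wl_fst {d : ℕ} (z : WithLp 2 (ℝ × Euc d)) : |z.fst| ≤ ‖z‖ := by
  refine abs_le_of_sq_le_sq ?_ (norm_nonneg _)
  rw [wl_norm]; nlinarith [sq_nonneg ‖z.snd‖]

theorem wl_snd {d : ℕ} (z : WithLp 2 (ℝ × Euc d)) : ‖z.snd‖ ≤ ‖z‖ := by
  refine (pow_le_pow_iff_left₀ (norm_nonneg _) (norm_nonneg _) two_ne_zero).1 ?_
  rw [wl_norm]; nlinarith [sq_nonneg z.fst]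

theorem wl_inner {d : ℕ} (z w : WithLp 2 (ℝ × Euc d)) : ⟪z, w⟫ = z.fst * w.fst + ⟪z.snd, w.snd⟫ := by
  rw [WithLp.prod_inner_apply]
  simp [mul_comm]

/-- pairs with the Euclidean norm -/
def mk2 {d : ℕ} (t : ℝ) (x : Euc d) : WithLp 2 (ℝ × Euc d) := WithLp.toLp 2 (t, x)

theorem mk2_fst {d : ℕ} (t : ℝ) (x : Euc d) : (mk2 t x).fst = t := rfl
theorem mk2_snd {d : ℕ} (t : ℝ) (x : Euc d) : (mk2 t x).snd = x := rfl

theorem bil_pull {d : ℕ} (X : WithLp 2 (ℝ × Euc d) →L[ℝ] WithLp 2 (ℝ × Euc d) →L[ℝ] ℝ) :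
    ∃ Q : (ℝ × Euc d) →L[ℝ] (ℝ × Euc d) →L[ℝ] ℝ, ∀ τ ξ, Q (τ, ξ) (τ, ξ) = X (mk2 τ ξ) (mk2 τ ξ) := by
  refine ⟨X.bilinearComp (WithLp.prodContinuousLinearEquiv 2 ℝ ℝ (Euc d)).symm.toContinuousLinearMap
    (WithLp.prodContinuousLinearEquiv 2 ℝ ℝ (Euc d)).symm.toContinuousLinearMap, fun τ ξ => ?_⟩
  rfl

/-- visc_jet in the form of the theorem on sums -/
theorem visc_jet2 (d : ℕ) (A : Euc d → Matrix (Fin d) (Fin d) ℝ) (H : Euc d → Euc d → ℝ) (T : ℝ)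
    (u : ℝ × Euc d → ℝ) (hu : IsViscSubsolution d A H T univ u) {n : ℕ}
    (S : Matrix (Fin d) (Fin n) ℝ) (γ m k h a b T' κ : ℝ) (hm : 0 ≤ m) (hk : 0 ≤ k)
    (X : WithLp 2 (ℝ × Euc d) →L[ℝ] WithLp 2 (ℝ × Euc d) →L[ℝ] ℝ)
    (P z : WithLp 2 (ℝ × Euc d)) (hz : z.fst ∈ Ioo a b) (hzT : z.fst + h ∈ Ioo 0 T)
    (hS : A z.snd = S * S.transpose) (u1 : WithLp 2 (ℝ × Euc d) → ℝ)
    (hu1 : ∀ y, u1 y = u (y.fst + h, y.snd) - κ - rho γ m k T' y.fst)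
    (hj : ∀ c > 0, ∃ r > 0, ∀ η, ‖η‖ ≤ r → (z + η).fst ∈ Icc a b →
        u1 (z + η) ≤ u1 z + ⟪P, η⟫ + X η η / 2 + c * ‖η‖ ^ 2) :
    γ + P.fst - ∑ i, X (mk2 0 (colv S i)) (mk2 0 (colv S i)) + H z.snd P.snd ≤ 0 := by
  obtain ⟨Q, hQ⟩ := bil_pull X
  have hv := visc_jet d A H T u hu S (rho (γ + P.fst) m k (T' + h)) (rho_contDiff _ _ _ _) P.snd Q
    (z.fst + h) hzT z.snd hS (by
      intro c hc
      obtain ⟨r, hr, hr'⟩ := hj c hc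
      have hd1 : 0 < z.fst - a := by linarith [hz.1]
      have hd2 : 0 < b - z.fst := by linarith [hz.2]
      refine ⟨min (r / 2) (min (z.fst - a) (b - z.fst)), by positivity, fun τ ξ hτ hξ _ => ?_⟩
      have t1 : |τ| ≤ r / 2 := hτ.trans (min_le_left _ _)
      have t2 : ‖ξ‖ ≤ r / 2 := hξ.trans (min_le_left _ _)
      have t3 : |τ| ≤ z.fst - a := hτ.trans ((min_le_right _ _).trans (min_le_left _ _))
      have t4 : |τ| ≤ b - z.fst := hτ.trans ((min_le_right _ _).trans (min_le_right _ _))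
      have hnn : ‖mk2 τ ξ‖ ^ 2 = τ ^ 2 + ‖ξ‖ ^ 2 := wl_norm _
      have hn : ‖mk2 τ ξ‖ ≤ r := by
        refine (pow_le_pow_iff_left₀ (norm_nonneg _) hr.le two_ne_zero).1 ?_
        rw [hnn, ← sq_abs τ]
        nlinarith [abs_nonneg τ, norm_nonneg ξ]
      have h1 := hr' (mk2 τ ξ) hn (by
        rw [WithLp.add_fst, mk2_fst]
        exact ⟨by linarith [(abs_le.1 t3).1], by linarith [(abs_le.1 t4).2]⟩)
      rw [hu1, hu1, hnn, ← hQ, wl_inner] at h1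
      simp only [WithLp.add_fst, WithLp.add_snd, mk2_fst, mk2_snd, rho] at h1 ⊢
      rw [show z.fst + h + τ - (T' + h) = z.fst + τ - T' by ring,
        show z.fst + h - (T' + h) = z.fst - T' by ring,
        show z.fst + h + τ = z.fst + τ + h by ring]
      linarith)
  have hr := rho_deriv (γ + P.fst) m k (T' + h) (z.fst + h) hm hk
  simp only [hQ] at hv
  linarith

set_option maxHeartbeats 4000000 in
theorem stepD (d : ℕ) (A : Euc d → Matrix (Fin d) (Fin d) ℝ) (H : Euc d → Euc d → ℝ) (T : ℝ)
    (Λ : ℝ) (hA : CondA d Λ A) (hH2 : CondH2 d H)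
    (u : ℝ × Euc d → ℝ) (hc : ContinuousOn u (Icc 0 T ×ˢ univ)) (C : ℝ)
    (hb : ∀ t ∈ Icc 0 T, ∀ x, |u (t, x)| ≤ C) (hsub : IsViscSubsolution d A H T univ u)
    (hsup : IsViscSubsolution d A (fun x p => - H x (-p)) T univ (fun z => - u z))
    (g : Euc d → ℝ) (L1 : ℝ) (hL1 : 0 ≤ L1) (hg : ∀ x y, |g x - g y| ≤ L1 * ‖x - y‖)
    (κ : ℝ) (hκ : 0 ≤ κ) (hug : ∀ t ∈ Icc 0 T, ∀ x, |u (t, x) - g x| ≤ κ * t)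
    (K : ℝ) (hK0 : 0 ≤ K) (hK : ∀ t ∈ Ioo 0 T, ∀ x y, |u (t, x) - u (t, y)| ≤ K * ‖x - y‖)
    (h : ℝ) (hh : 0 < h) (hhT : h < T) :
    ∀ t ∈ Icc 0 (T - h), ∀ x, u (t + h, x) - u (t, x) ≤ κ * h := by
  suffices hmain : ∀ t ∈ Ico 0 (T - h), ∀ x, u (t + h, x) - u (t, x) ≤ κ * h by
    intro t ht x
    refine extend_right (T - h) (by linarith) (fun t => u (t + h, x) - u (t, x)) ?_ (κ * h)
      (fun t ht => hmain t ht x) t ht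
    refine ContinuousOn.sub (hc.comp (by fun_prop) (fun t ht => ⟨⟨?_, ?_⟩, mem_univ _⟩))
      (hc.comp (by fun_prop) (fun t ht => ⟨⟨?_, ?_⟩, mem_univ _⟩))
    · have := ht.1; simp only; linarith
    · have := ht.2; simp only; linarith
    · exact ht.1
    · have := ht.2; simp only; linarith
  intro t0 ht0 x0
  by_contra hcon
  push Not at hcon
  set T' := T - h with hT'
  have hT'0 : 0 < T' := by linarith
  have hC0 : 0 ≤ C := (abs_nonneg _).trans (hb 0 ⟨le_rfl, by linarith⟩ x0)
  obtain ⟨θ, hθ, hθ'⟩ : ∃ θ > 0, 4 * θ ≤ u (t0 + h, x0) - u (t0, x0) - κ * h :=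
    ⟨(u (t0 + h, x0) - u (t0, x0) - κ * h) / 4, by linarith, by linarith⟩
  have hgt := ((small_ev t0 θ hθ).and self_mem_nhdsWithin).exists
  obtain ⟨γ, hγ1, hγ⟩ := hgt
  set m := 2 * C + 1 with hm
  have hm0 : 0 ≤ m := by positivity
  obtain ⟨k, hk0, hk⟩ := exp_small t0 T' m θ ht0.2 hθ
  -- uniform continuity
  obtain ⟨ω, hω, hω'⟩ := Metric.uniformContinuousOn_iff.1 (hH2 (2 * K + 1) (by positivity)) (γ / 4)
    (by positivity)
  set z0 : WithLp 2 (ℝ × Euc d) := mk2 t0 x0 with hz0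
  set s0 := min ω (min γ 1) with hs0
  have hs00 : 0 < s0 := by positivity
  have hs01 : s0 ≤ ω := min_le_left _ _
  have hs02 : s0 ≤ γ := (min_le_right _ _).trans (min_le_left _ _)
  have hs03 : s0 ≤ 1 := (min_le_right _ _).trans (min_le_right _ _)
  obtain ⟨η, hη0, hη⟩ : ∃ η > 0, 16 * η = s0 := ⟨s0 / 16, by positivity, by ring⟩
  obtain ⟨β, ⟨⟨⟨hβ1, hβ2⟩, hβ3⟩, hβ4⟩, hβ⟩ := (((((small_ev (2 * ‖z0‖ ^ 2 + 2 * ‖z0‖ + 1) θ hθ).and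
    (small_ev (4 * C) (η ^ 2) (by positivity))).and (small_ev 2 η hη0)).and
    (small_ev (4 * Λ ^ 2) (γ / 8) (by positivity))).and self_mem_nhdsWithin).exists
  obtain ⟨q, ⟨hq1, hq2⟩, hq⟩ := (((small_ev 3 h hh).and
    (small_ev (3 * (L1 + κ)) θ hθ)).and self_mem_nhdsWithin).exists
  obtain ⟨ε, ⟨⟨hε1, hε2⟩, hε3⟩, hε⟩ := ((((small_ev (4 * C) (q ^ 2) (by positivity)).and
    (small_ev (6 * K + 1) ω hω)).and
    (small_ev (Λ ^ 2 * (6 * K + 1) ^ 2) (γ / 8) (by positivity))).and self_mem_nhdsWithin).exists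
  set D1 : Set (WithLp 2 (ℝ × Euc d)) := {z | z.fst ∈ Icc 0 T'} with hD1
  set D2 : Set (WithLp 2 (ℝ × Euc d)) := {z | z.fst ∈ Icc 0 T} with hD2
  have cf : Continuous (fun z : WithLp 2 (ℝ × Euc d) => z.fst) := WithLp.continuous_fst 2 ℝ (Euc d)
  have cs : Continuous (fun z : WithLp 2 (ℝ × Euc d) => z.snd) := WithLp.continuous_snd 2 ℝ (Euc d)
  set u1 : WithLp 2 (ℝ × Euc d) → ℝ := fun y => u (y.fst + h, y.snd) - κ * h - rho γ m k T' y.fst with hu1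
  set u2 : WithLp 2 (ℝ × Euc d) → ℝ := fun y => - u (y.fst, y.snd) with hu2
  have hDT : ∀ z ∈ D1, z.fst + h ∈ Icc 0 T := fun z hz =>
    ⟨by linarith [hz.1], by linarith [hz.2]⟩
  have hrho : ∀ z ∈ D1, 0 ≤ rho γ m k T' z.fst := by
    intro z hz
    have : 0 ≤ z.fst := hz.1
    unfold rho; positivity
  have hrc := (rho_contDiff γ m k T').continuous
  have hc1 : ContinuousOn u1 D1 := by
    refine ((hc.comp ?_ ?_).sub continuousOn_const).sub (hrc.comp cf).continuousOn
    · exact ((cf.add continuous_const).prodMk cs).continuousOn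
    · exact fun z hz => ⟨hDT z hz, mem_univ _⟩
  have hc2 : ContinuousOn u2 D2 := by
    refine (hc.comp ?_ ?_).neg
    · exact (cf.prodMk cs).continuousOn
    · exact fun z hz => ⟨hz, mem_univ _⟩
  have hκh : 0 ≤ κ * h := by positivity
  have hb1 : ∀ x ∈ D1, u1 x ≤ C := by
    intro x hx
    have h1 := (abs_le.1 (hb _ (hDT x hx) x.snd)).2
    have h2 := hrho x hx
    simp only [hu1]; linarith
  have hb2 : ∀ x ∈ D2, u2 x ≤ C := by
    intro x hx
    have h1 := (abs_le.1 (hb _ hx x.snd)).1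
    simp only [hu2]; linarith
  have hz1 : z0 ∈ D1 := ⟨ht0.1, ht0.2.le⟩
  have hz2 : z0 ∈ D2 := ⟨ht0.1, by have := ht0.2; show t0 ≤ T; linarith⟩
  obtain ⟨z, w, z', w', p1, p2, X, Y, hz', hw', hp1, hp2, hmax, hj1, hj2, hXY⟩ :=
    sums D1 D2 (isClosed_Icc.preimage cf) (isClosed_Icc.preimage cf) ⟨z0, hz1⟩ ⟨z0, hz2⟩ u1 u2 hc1 hc2
      C hb1 hb2 ε β β hε hβ hβ
  have hval := psi_val u1 u2 ε β θ hβ p1 p2 z w z' w' z0 hp1 hp2 (hmax z0 z0 z0 hz1 z0 hz2) (by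
    simp only [hu1, hu2, rho, hz0, mk2_fst, mk2_snd]
    linarith) hβ1
  have hup : u1 z' + u2 w' ≤ 2 * C := by linarith [hb1 z' hz', hb2 w' hw']
  have hst1 := psi_stat u1 u2 ε β hε hβ p1 p2 z w z' w' (fun c => hmax c w z' hz' w' hw')
  have hst2 := psi_stat2 u1 u2 ε β hε hβ p1 p2 z w z' w' (fun c => hmax z c z' hz' w' hw')
  set P := (1 / ε) • (z - w) + (2 * β) • z + p1 with hP
  set R := (1 / ε) • (w - z) + (2 * β) • w + p2 with hR
  -- distances
  have hnn : 0 ≤ β / 2 * (‖z‖ ^ 2 + ‖w‖ ^ 2) := by positivity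
  have hdd : ‖z - z'‖ ^ 2 + ‖w - w'‖ ^ 2 + ‖z - w‖ ^ 2 ≤ q ^ 2 := by
    have : (‖z - z'‖ ^ 2 + ‖w - w'‖ ^ 2 + ‖z - w‖ ^ 2) / (2 * ε) ≤ 2 * C := by linarith
    rw [div_le_iff₀ (by positivity)] at this
    linarith
  have hsq : ∀ a : WithLp 2 (ℝ × Euc d), ‖a‖ ^ 2 ≤ q ^ 2 → ‖a‖ ≤ q := fun a ha =>
    (pow_le_pow_iff_left₀ (norm_nonneg _) hq.le two_ne_zero).1 ha
  have hd1 : ‖z - z'‖ ≤ q := hsq _ (by linarith [sq_nonneg ‖w - w'‖, sq_nonneg ‖z - w‖])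
  have hd2 : ‖w - w'‖ ≤ q := hsq _ (by linarith [sq_nonneg ‖z - z'‖, sq_nonneg ‖z - w‖])
  have hd3 : ‖z - w‖ ≤ q := hsq _ (by linarith [sq_nonneg ‖z - z'‖, sq_nonneg ‖w - w'‖])
  have hd4 : ‖z' - w'‖ ≤ 3 * q := by
    rw [show z' - w' = (z - w) - (z - z') + (w - w') by abel]
    refine (norm_add_le _ _).trans ?_
    have := norm_sub_le (z - w) (z - z')
    linarith
  have hdn : 0 ≤ (‖z - z'‖ ^ 2 + ‖w - w'‖ ^ 2 + ‖z - w‖ ^ 2) / (2 * ε) := by positivity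
  have hβz : ∀ a : WithLp 2 (ℝ × Euc d), ‖a‖ ^ 2 ≤ ‖z‖ ^ 2 + ‖w‖ ^ 2 → β * ‖a‖ ≤ η := by
    intro a ha
    refine (pow_le_pow_iff_left₀ (by positivity) hη0.le two_ne_zero).1 ?_
    have h1 : β / 2 * ‖a‖ ^ 2 ≤ β / 2 * (‖z‖ ^ 2 + ‖w‖ ^ 2) := by gcongr
    have h2 : β * (β / 2 * ‖a‖ ^ 2) ≤ β * (2 * C) :=
      mul_le_mul_of_nonneg_left (by linarith) hβ.le
    rw [mul_pow]
    linarith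
  have hβz1 := hβz z (by linarith [sq_nonneg ‖w‖])
  have hβw1 := hβz w (by linarith [sq_nonneg ‖z‖])
  have ht'w : |z'.fst - w'.fst| ≤ 3 * q := (wl_fst (z' - w')).trans hd4
  have hx'y : ‖z'.snd - w'.snd‖ ≤ 3 * q := (wl_snd (z' - w')).trans hd4
  have hpos : 0 < z'.fst ∧ 0 < w'.fst := by
    by_contra hne
    have e1 : z'.fst + w'.fst ≤ 3 * q := by
      rw [not_and_or] at hne
      have h1 := abs_le.1 ht'w
      rcases hne with h2 | h2
      · linarith
      · linarith
    have f1 := (abs_le.1 (hug _ (hDT z' hz') z'.snd)).2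
    have f2 := (abs_le.1 (hug _ hw' w'.snd)).1
    have f3 := (abs_le.1 (hg z'.snd w'.snd)).2
    have f4 := hrho z' hz'
    have f5 : L1 * ‖z'.snd - w'.snd‖ ≤ L1 * (3 * q) := by gcongr
    have f6 : κ * (z'.fst + w'.fst) ≤ κ * (3 * q) := by gcongr
    have f7 : u1 z' + u2 w' < θ := by
      simp only [hu1, hu2]
      linarith
    linarith
  have htT : z'.fst < T' := by
    rcases lt_or_eq_of_le hz'.2 with h1 | h1
    · exact h1
    · exfalso
      have f1 := (abs_le.1 (hb _ (hDT z' hz') z'.snd)).2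
      have f2 := hb2 w' hw'
      have f3 : u1 z' ≤ C - m := by
        simp only [hu1, rho, h1, sub_self, mul_zero, Real.exp_zero, mul_one]
        rw [h1] at f1
        have : 0 ≤ γ * T' := by positivity
        linarith
      linarith
  have hsT : w'.fst < T := by
    have h1 := abs_le.1 ht'w
    linarith
  have hz'I : z'.fst + h ∈ Ioo 0 T := ⟨by linarith [hpos.1], by linarith⟩
  -- Lipschitz in space
  have hxx : ‖z.snd - z'.snd‖ ≤ 2 * ε * K := by
    have h1 := hmax z w (mk2 z'.fst z.snd) hz' w' hw'
    unfold Psi at h1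
    have h2 := (abs_le.1 (hK _ hz'I z'.snd z.snd)).2
    rw [norm_sub_rev] at h2
    rw [wl_norm (z - mk2 z'.fst z.snd), wl_norm (z - z')] at h1
    simp only [WithLp.sub_fst, WithLp.sub_snd, mk2_fst, mk2_snd, sub_self, norm_zero, hu1] at h1
    have h3 : ‖z.snd - z'.snd‖ ^ 2 / (2 * ε) ≤ K * ‖z.snd - z'.snd‖ := by
      simp only [add_div] at h1
      norm_num at h1
      linarith
    rw [div_le_iff₀ (by positivity)] at h3
    by_contra hne
    push Not at hne
    have h4 : 0 < ‖z.snd - z'.snd‖ := lt_of_le_of_lt (by positivity) hne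
    have h5 := mul_lt_mul_of_pos_right hne h4
    linarith
  have hyy : ‖w.snd - w'.snd‖ ≤ 2 * ε * K := by
    have h1 := hmax z w z' hz' (mk2 w'.fst w.snd) hw'
    unfold Psi at h1
    have h2 := (abs_le.1 (hK _ ⟨hpos.2, hsT⟩ w'.snd w.snd)).1
    rw [norm_sub_rev] at h2
    rw [wl_norm (w - mk2 w'.fst w.snd), wl_norm (w - w')] at h1
    simp only [WithLp.sub_fst, WithLp.sub_snd, mk2_fst, mk2_snd, sub_self, norm_zero, hu2] at h1
    have h3 : ‖w.snd - w'.snd‖ ^ 2 / (2 * ε) ≤ K * ‖w.snd - w'.snd‖ := by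
      simp only [add_div] at h1
      norm_num at h1
      linarith
    rw [div_le_iff₀ (by positivity)] at h3
    by_contra hne
    push Not at hne
    have h4 : 0 < ‖w.snd - w'.snd‖ := lt_of_le_of_lt (by positivity) hne
    have h5 := mul_lt_mul_of_pos_right hne h4
    linarith
  have hscale : ∀ a b : Euc d, ‖a - b‖ ≤ 2 * ε * K → ‖(1 / ε) • (b - a)‖ ≤ 2 * K := by
    intro a b hab
    rw [norm_smul, Real.norm_of_nonneg (by positivity), norm_sub_rev, div_mul_eq_mul_div,
      div_le_iff₀ hε]
    linarith
  have hPx : ‖P.snd‖ ≤ 2 * K := by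
    rw [hst1, WithLp.smul_snd, WithLp.sub_snd]
    exact hscale _ _ hxx
  have hRx : ‖R.snd‖ ≤ 2 * K := by
    rw [hst2, WithLp.smul_snd, WithLp.sub_snd]
    exact hscale _ _ hyy
  have hPR : ‖P + R‖ ≤ 4 * η + 2 * β := by
    have : P + R = (2 * β) • z + (2 * β) • w + p1 + p2 := by
      rw [hP, hR]; module
    rw [this]
    refine (norm_add₄_le).trans ?_
    rw [norm_smul, norm_smul, Real.norm_of_nonneg (by positivity)]
    linarith
  have hzw : ‖z.snd - w.snd‖ ≤ ε * (2 * K + 1) := by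
    have e1 : z.snd - w.snd = ε • (P.snd - ((2 * β) • z + p1).snd) := by
      rw [← WithLp.sub_snd, ← WithLp.sub_snd, ← WithLp.smul_snd]
      congr 1
      rw [hP, show (1 / ε) • (z - w) + (2 * β) • z + p1 - ((2 * β) • z + p1) = (1 / ε) • (z - w) by abel,
        smul_smul, mul_one_div_cancel hε.ne', one_smul]
    rw [e1, norm_smul, Real.norm_of_nonneg hε.le]
    gcongr
    refine (norm_sub_le _ _).trans ?_
    have e2 : ‖((2 * β) • z + p1).snd‖ ≤ 2 * η + β := by
      refine (wl_snd _).trans ((norm_add_le _ _).trans ?_)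
      rw [norm_smul, Real.norm_of_nonneg (by positivity)]
      linarith
    linarith
  have hxy : ‖z'.snd - w'.snd‖ ≤ ε * (6 * K + 1) := by
    rw [show z'.snd - w'.snd = (z.snd - w.snd) - (z.snd - z'.snd) + (w.snd - w'.snd) by abel]
    refine (norm_add_le _ _).trans ?_
    have := norm_sub_le (z.snd - w.snd) (z.snd - z'.snd)
    linarith
  -- viscosity inequalities
  obtain ⟨n, σ, hσ, hσb, hσl⟩ := hA
  have hv1 := visc_jet2 d A H T u hsub (σ z'.snd) γ m k h 0 T' T' (κ * h) hm0 hk0 X P z' ⟨hpos.1, htT⟩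
    hz'I (hσ _) u1 (fun y => rfl) hj1
  have hv2 := visc_jet2 d A _ T _ hsup (σ w'.snd) 0 0 0 0 0 T 0 0 le_rfl le_rfl Y R w' ⟨hpos.2, hsT⟩
    (by rw [add_zero]; exact ⟨hpos.2, hsT⟩) (hσ _) u2 (fun y => by simp [hu2, rho]) hj2
  have hsum : ∑ i, X (mk2 0 (colv (σ z'.snd) i)) (mk2 0 (colv (σ z'.snd) i)) +
      ∑ i, Y (mk2 0 (colv (σ w'.snd) i)) (mk2 0 (colv (σ w'.snd) i)) ≤
      ε * (Λ ^ 2 * (6 * K + 1) ^ 2) + β * (4 * Λ ^ 2) := by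
    have hn2 : ∀ a : Euc d, ‖mk2 0 a‖ ^ 2 = ‖a‖ ^ 2 := fun a => by
      rw [wl_norm]; simp [mk2_fst, mk2_snd]
    have hms : ∀ a b : Euc d, ‖mk2 0 a - mk2 0 b‖ ^ 2 = ‖a - b‖ ^ 2 := fun a b => by
      rw [wl_norm]; simp [mk2_fst, mk2_snd]
    rw [← Finset.sum_add_distrib]
    refine (Finset.sum_le_sum fun i _ => hXY _ _).trans ?_
    simp only [hn2, hms, ← colv_sub]
    rw [Finset.sum_add_distrib, ← Finset.sum_div, ← Finset.mul_sum, Finset.sum_add_distrib]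
    have g1 := condA_col _ _ (hσl z'.snd w'.snd)
    have g2 := condA_col _ _ (hσb z'.snd)
    have g3 := condA_col _ _ (hσb w'.snd)
    have g4 : (∑ i, ‖colv (σ z'.snd - σ w'.snd) i‖ ^ 2) / ε ≤ ε * (Λ ^ 2 * (6 * K + 1) ^ 2) := by
      rw [div_le_iff₀ hε]
      refine g1.trans ?_
      have g5 : ‖z'.snd - w'.snd‖ ^ 2 ≤ (ε * (6 * K + 1)) ^ 2 := by gcongr
      calc (Λ * ‖z'.snd - w'.snd‖) ^ 2 = Λ ^ 2 * ‖z'.snd - w'.snd‖ ^ 2 := by ring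
        _ ≤ Λ ^ 2 * (ε * (6 * K + 1)) ^ 2 := by gcongr
        _ = _ := by ring
    have g6 : 2 * β * (∑ i, ‖colv (σ z'.snd) i‖ ^ 2 + ∑ i, ‖colv (σ w'.snd) i‖ ^ 2) ≤
        2 * β * (Λ ^ 2 + Λ ^ 2) := by gcongr
    linarith
  have hHd : |H z'.snd P.snd - H w'.snd (-R.snd)| < γ / 4 := by
    have := hω' (z'.snd, P.snd) ⟨mem_univ _, by rw [mem_ball_zero_iff]; linarith⟩
      (w'.snd, -R.snd) ⟨mem_univ _, by rw [mem_ball_zero_iff, norm_neg]; linarith⟩ (by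
        rw [Prod.dist_eq, max_lt_iff]
        constructor
        · rw [dist_eq_norm]; simp only; linarith
        · rw [dist_eq_norm]
          simp only [sub_neg_eq_add]
          have := (wl_snd (P + R)).trans hPR
          rw [WithLp.add_snd] at this
          linarith)
    rwa [Real.dist_eq] at this
  have hPRt : |P.fst + R.fst| ≤ 4 * η + 2 * β := (wl_fst (P + R)).trans hPR
  have i1 := (abs_le.1 hPRt).1
  have i2 := (abs_lt.1 hHd).1
  linarith

theorem condH2_neg (d : ℕ) (H : Euc d → Euc d → ℝ) (h : CondH2 d H) :
    CondH2 d (fun x p => - H x (-p)) := by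
  intro r hr
  rw [Metric.uniformContinuousOn_iff]
  intro e he
  obtain ⟨δ, hδ, h'⟩ := Metric.uniformContinuousOn_iff.1 (h r hr) e he
  refine ⟨δ, hδ, fun a ha b hb hab => ?_⟩
  have := h' (a.1, -a.2) ⟨mem_univ _, by simpa using ha.2⟩ (b.1, -b.2) ⟨mem_univ _, by simpa using hb.2⟩
    (by simpa [Prod.dist_eq] using hab)
  simpa using this

theorem final_half (d : ℕ) (A : Euc d → Matrix (Fin d) (Fin d) ℝ) (H : Euc d → Euc d → ℝ) (T : ℝ)
    (Λ : ℝ) (hA : CondA d Λ A) (hH2 : CondH2 d H)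
    (u : ℝ × Euc d → ℝ) (hc : ContinuousOn u (Icc 0 T ×ˢ univ)) (C : ℝ)
    (hb : ∀ t ∈ Icc 0 T, ∀ x, |u (t, x)| ≤ C) (hsub : IsViscSubsolution d A H T univ u)
    (hsup : IsViscSubsolution d A (fun x p => - H x (-p)) T univ (fun z => - u z))
    (g : Euc d → ℝ) (L1 : ℝ) (hL1 : 0 ≤ L1) (hg : ∀ x y, |g x - g y| ≤ L1 * ‖x - y‖)
    (κ : ℝ) (hκ : 0 ≤ κ) (hug : ∀ t ∈ Icc 0 T, ∀ x, |u (t, x) - g x| ≤ κ * t)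
    (K : ℝ) (hK0 : 0 ≤ K) (hK : ∀ t ∈ Ioo 0 T, ∀ x y, |u (t, x) - u (t, y)| ≤ K * ‖x - y‖)
    (t s : ℝ) (hs : 0 ≤ s) (hst : s ≤ t) (ht : t ≤ T) (x : Euc d) :
    u (t, x) - u (s, x) ≤ κ * (t - s) := by
  rcases eq_or_lt_of_le hst with h1 | h1
  · subst h1; simp
  · rcases lt_or_ge (t - s) T with h2 | h2
    · have := stepD d A H T Λ hA hH2 u hc C hb hsub hsup g L1 hL1 hg κ hκ hug K hK0 hK (t - s)
        (by linarith) h2 s ⟨hs, by linarith⟩ x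
      rwa [add_sub_cancel] at this
    · have hs0 : s = 0 := by linarith
      subst hs0
      have e1 := (abs_le.1 (hug t ⟨by linarith, ht⟩ x)).2
      have e2 := (abs_le.1 (hug 0 ⟨le_rfl, by linarith⟩ x)).1
      linarith

/-- **Lipschitz estimate in time** (Proposition `prop t-Lip`): a bounded continuous
viscosity solution with initial datum `g ∈ W^{2,∞}(ℝ^d)` that is Lipschitz in space
uniformly in time is Lipschitz in time, with a constant depending only on
`‖Dg‖_∞`, `‖D²g‖_∞`, `μ`, `Λ_A` and `Θ`. -/
theorem statement4 :
    ∃ κF : ℝ → ℝ → ℝ → ℝ → (ℝ → ℝ) → ℝ,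
      ∀ (d : ℕ), 0 < d → ∀ T : ℝ, 0 < T →
      ∀ ΛA : ℝ, 0 < ΛA → ∀ A : Euc d → Matrix (Fin d) (Fin d) ℝ, CondA d ΛA A →
      ∀ (μ : ℝ) (Θ : ℝ → ℝ) (H : Euc d → Euc d → ℝ), CondH1 d μ Θ H → CondH2 d H →
      ∀ (g : Euc d → ℝ) (L1 L2 : ℝ),
        (∃ C : ℝ, ∀ x, |g x| ≤ C) →
        Differentiable ℝ g →
        (∀ x, ‖fderiv ℝ g x‖ ≤ L1) →
        (∀ x y, ‖fderiv ℝ g x - fderiv ℝ g y‖ ≤ L2 * ‖x - y‖) →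
      ∀ u : ℝ × Euc d → ℝ,
        ContinuousOn u (Icc 0 T ×ˢ (univ : Set (Euc d))) →
        (∃ C : ℝ, ∀ t ∈ Icc (0 : ℝ) T, ∀ x : Euc d, |u (t, x)| ≤ C) →
        IsViscSubsolution d A H T univ u →
        IsViscSupersolution d A H T univ u →
        (∀ x, u (0, x) = g x) →
        (∃ κ' : ℝ, ∀ t ∈ Ioo (0 : ℝ) T, ∀ x y : Euc d,
          |u (t, x) - u (t, y)| ≤ κ' * ‖x - y‖) →
        ∀ t ∈ Icc (0 : ℝ) T, ∀ s ∈ Icc (0 : ℝ) T, ∀ x : Euc d,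
          |u (t, x) - u (s, x)| ≤ κF L1 L2 μ ΛA Θ * |t - s| := by
  refine ⟨fun L1 L2 μ Λ Θ => 2 * |L2| * Λ ^ 2 + |μ| + |Θ (L1 + 1)| + 1, ?_⟩
  intro d hd T hT Λ hΛ A hA μ Θ H hH1 hH2 g L1 L2 hgb hgd hg1 hg2 u hc hub hsub hsuper h0 hlip t ht s hs x
  obtain ⟨Cg, hCg⟩ := hgb
  obtain ⟨Cu, hCu⟩ := hub
  obtain ⟨κ', hκ'⟩ := hlip
  obtain ⟨-, hΘm, -, hHb⟩ := hH1
  set κ := 2 * |L2| * Λ ^ 2 + |μ| + |Θ (L1 + 1)| + 1 with hκ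
  have hκ0 : 0 ≤ κ := by positivity
  have hL1 : 0 ≤ L1 := (norm_nonneg _).trans (hg1 0)
  have hL2 : 0 ≤ L2 := by
    have h := (norm_nonneg _).trans (hg2 (EuclideanSpace.single ⟨0, hd⟩ 1) 0)
    simpa using h
  have hLL : |L2| = L2 := abs_of_nonneg hL2
  have hsup := super_neg d A H T u hsuper
  have hsemi := g_semi g L1 L2 hL2 hgd hg1 hg2
  have hgL : ∀ x y, |g x - g y| ≤ L1 * ‖x - y‖ := by
    intro x y
    have := convex_univ.norm_image_sub_le_of_norm_fderiv_le (𝕜 := ℝ) (f := g) (C := L1)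
      (fun y _ => hgd y) (fun y _ => hg1 y) (mem_univ y) (mem_univ x)
    simpa using this
  have hup := stepC d A H T hT Λ hA u hc (max Cu Cg) (fun t ht x => (hCu t ht x).trans (le_max_left _ _))
    hsub g hgd.continuous (fun x => (hCg x).trans (le_max_right _ _)) (fun x => (h0 x).le) L1 (2 * L2) μ κ
    (by positivity) (fun x0 => by
      obtain ⟨p, hp, hp'⟩ := hsemi x0
      refine ⟨p, hp, fun x => ?_⟩
      have := (abs_le.1 (hp' x)).2
      linarith) (fun x p _ => (hHb x p).1) (by
      rw [hκ, hLL]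
      have := le_abs_self μ
      have := abs_nonneg (Θ (L1 + 1))
      linarith)
  have hdn := stepC d A _ T hT Λ hA (fun z => - u z) hc.neg (max Cu Cg)
    (fun t ht x => by rw [abs_neg]; exact (hCu t ht x).trans (le_max_left _ _))
    hsup (fun x => - g x) hgd.continuous.neg
    (fun x => by rw [abs_neg]; exact (hCg x).trans (le_max_right _ _))
    (fun x => by rw [h0 x]) L1 (2 * L2) (Θ (L1 + 1)) κ
    (by positivity) (fun x0 => by
      obtain ⟨p, hp, hp'⟩ := hsemi x0
      refine ⟨-p, by rwa [norm_neg], fun x => ?_⟩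
      have := (abs_le.1 (hp' x)).1
      rw [inner_neg_left]
      linarith) (fun x p hp => by
      have h1 := (hHb x (-p)).2
      rw [norm_neg] at h1
      have h2 := hΘm hp
      linarith) (by
      rw [hκ, hLL]
      have := le_abs_self (Θ (L1 + 1))
      have := abs_nonneg μ
      linarith)
  have hug : ∀ t ∈ Icc 0 T, ∀ x, |u (t, x) - g x| ≤ κ * t := by
    intro t ht x
    have h1 := hup t ht x
    have h2 := hdn t ht x
    rw [abs_le]
    constructor <;> linarith
  have hK : ∀ t ∈ Ioo (0 : ℝ) T, ∀ x y : Euc d, |u (t, x) - u (t, y)| ≤ |κ'| * ‖x - y‖ := by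
    intro t ht x y
    refine (hκ' t ht x y).trans ?_
    gcongr
    exact le_abs_self _
  have hug' : ∀ t ∈ Icc 0 T, ∀ x, |- u (t, x) - - g x| ≤ κ * t := by
    intro t ht x
    rw [show - u (t, x) - - g x = - (u (t, x) - g x) by ring, abs_neg]
    exact hug t ht x
  have hK' : ∀ t ∈ Ioo (0 : ℝ) T, ∀ x y : Euc d, |- u (t, x) - - u (t, y)| ≤ |κ'| * ‖x - y‖ := by
    intro t ht x y
    rw [show - u (t, x) - - u (t, y) = - (u (t, x) - u (t, y)) by ring, abs_neg]
    exact hK t ht x y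
  have hgL' : ∀ x y, |- g x - - g y| ≤ L1 * ‖x - y‖ := by
    intro x y
    rw [show - g x - - g y = - (g x - g y) by ring, abs_neg]
    exact hgL x y
  have hab : ∀ t s : ℝ, 0 ≤ s → s ≤ t → t ≤ T → |u (t, x) - u (s, x)| ≤ κ * (t - s) := by
    intro t s hs hst ht
    have h1 := final_half d A H T Λ hA hH2 u hc Cu hCu hsub hsup g L1 hL1 hgL κ hκ0 hug |κ'|
      (abs_nonneg _) hK t s hs hst ht x
    have h2 := final_half d A _ T Λ hA (condH2_neg d H hH2) (fun z => - u z) hc.neg Cu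
      (fun t ht x => by rw [abs_neg]; exact hCu t ht x) hsup (sub_neg' d A H T u hsub) (fun x => - g x) L1
      hL1 hgL' κ hκ0 hug' |κ'| (abs_nonneg _) hK' t s hs hst ht x
    rw [abs_le]
    constructor <;> linarith
  rcases le_total s t with hst | hst
  · rw [abs_of_nonneg (sub_nonneg.2 hst)]
    exact hab t s hs.1 hst ht.2
  · rw [abs_sub_comm, abs_sub_comm t s, abs_of_nonneg (sub_nonneg.2 hst)]
    exact hab s t ht.1 hst hs.2
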